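/- arXiv:2506.12638 — 2 statements merged into one kernel-verified Lean document; each statement's English description precedes it below -/
import Mathlib

section
/- Let A = ℤ[∛5] be the ring of integers of the cubic field ℚ(∛5). Then SL₂(ℤ[∛5])^ab ≅ ℤ/12. -/
open NumberField

/-- The abelianization of `SL₂(R)`, written additively. -/
abbrev SL2ab (R : Type*) [CommRing R] : Type _ :=
  Additive (Abelianization (Matrix.SpecialLinearGroup (Fin 2) R))

/-- The ring `ℤ[θ]` with `θ ^ 3 = 5`; the element `⟨a, b, c⟩` stands for `a + b θ + c θ ^ 2`. -/
@[ext]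
structure ZCbrtFive where
  /-- The constant coordinate. -/
  a : ℤ
  /-- The coordinate along `θ`. -/
  b : ℤ
  /-- The coordinate along `θ ^ 2`. -/
  c : ℤ
  deriving DecidableEq

namespace ZCbrtFive

instance : Zero ZCbrtFive := ⟨⟨0, 0, 0⟩⟩
instance : One ZCbrtFive := ⟨⟨1, 0, 0⟩⟩
instance : Add ZCbrtFive := ⟨fun x y => ⟨x.a + y.a, x.b + y.b, x.c + y.c⟩⟩
instance : Neg ZCbrtFive := ⟨fun x => ⟨-x.a, -x.b, -x.c⟩⟩
instance : Sub ZCbrtFive := ⟨fun x y => ⟨x.a - y.a, x.b - y.b, x.c - y.c⟩⟩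
instance : Mul ZCbrtFive := ⟨fun x y =>
  ⟨x.a * y.a + 5 * (x.b * y.c + x.c * y.b), x.a * y.b + x.b * y.a + 5 * (x.c * y.c),
    x.a * y.c + x.b * y.b + x.c * y.a⟩⟩
instance : IntCast ZCbrtFive := ⟨fun n => ⟨n, 0, 0⟩⟩
instance : NatCast ZCbrtFive := ⟨fun n => ⟨n, 0, 0⟩⟩
instance : SMul ℕ ZCbrtFive := ⟨fun n x => ⟨n * x.a, n * x.b, n * x.c⟩⟩
instance : SMul ℤ ZCbrtFive := ⟨fun n x => ⟨n * x.a, n * x.b, n * x.c⟩⟩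

@[simp] lemma zero_a : (0 : ZCbrtFive).a = 0 := rfl
@[simp] lemma zero_b : (0 : ZCbrtFive).b = 0 := rfl
@[simp] lemma zero_c : (0 : ZCbrtFive).c = 0 := rfl
@[simp] lemma one_a : (1 : ZCbrtFive).a = 1 := rfl
@[simp] lemma one_b : (1 : ZCbrtFive).b = 0 := rfl
@[simp] lemma one_c : (1 : ZCbrtFive).c = 0 := rfl
@[simp] lemma add_a (x y : ZCbrtFive) : (x + y).a = x.a + y.a := rfl
@[simp] lemma add_b (x y : ZCbrtFive) : (x + y).b = x.b + y.b := rfl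
@[simp] lemma add_c (x y : ZCbrtFive) : (x + y).c = x.c + y.c := rfl
@[simp] lemma neg_a (x : ZCbrtFive) : (-x).a = -x.a := rfl
@[simp] lemma neg_b (x : ZCbrtFive) : (-x).b = -x.b := rfl
@[simp] lemma neg_c (x : ZCbrtFive) : (-x).c = -x.c := rfl
@[simp] lemma sub_a (x y : ZCbrtFive) : (x - y).a = x.a - y.a := rfl
@[simp] lemma sub_b (x y : ZCbrtFive) : (x - y).b = x.b - y.b := rfl
@[simp] lemma sub_c (x y : ZCbrtFive) : (x - y).c = x.c - y.c := rfl
@[simp] lemma mul_a (x y : ZCbrtFive) :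
    (x * y).a = x.a * y.a + 5 * (x.b * y.c + x.c * y.b) := rfl
@[simp] lemma mul_b (x y : ZCbrtFive) :
    (x * y).b = x.a * y.b + x.b * y.a + 5 * (x.c * y.c) := rfl
@[simp] lemma mul_c (x y : ZCbrtFive) :
    (x * y).c = x.a * y.c + x.b * y.b + x.c * y.a := rfl
@[simp] lemma intCast_a (n : ℤ) : (n : ZCbrtFive).a = n := rfl
@[simp] lemma intCast_b (n : ℤ) : (n : ZCbrtFive).b = 0 := rfl
@[simp] lemma intCast_c (n : ℤ) : (n : ZCbrtFive).c = 0 := rfl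
@[simp] lemma natCast_a (n : ℕ) : (n : ZCbrtFive).a = n := rfl
@[simp] lemma natCast_b (n : ℕ) : (n : ZCbrtFive).b = 0 := rfl
@[simp] lemma natCast_c (n : ℕ) : (n : ZCbrtFive).c = 0 := rfl
@[simp] lemma nsmul_a (n : ℕ) (x : ZCbrtFive) : (n • x).a = n * x.a := rfl
@[simp] lemma nsmul_b (n : ℕ) (x : ZCbrtFive) : (n • x).b = n * x.b := rfl
@[simp] lemma nsmul_c (n : ℕ) (x : ZCbrtFive) : (n • x).c = n * x.c := rfl
@[simp] lemma zsmul_a (n : ℤ) (x : ZCbrtFive) : (n • x).a = n * x.a := rfl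
@[simp] lemma zsmul_b (n : ℤ) (x : ZCbrtFive) : (n • x).b = n * x.b := rfl
@[simp] lemma zsmul_c (n : ℤ) (x : ZCbrtFive) : (n • x).c = n * x.c := rfl

instance : CommRing ZCbrtFive where
  add_assoc _ _ _ := by ext <;> simp <;> ring
  zero_add _ := by ext <;> simp
  add_zero _ := by ext <;> simp
  add_comm _ _ := by ext <;> simp <;> ring
  neg_add_cancel _ := by ext <;> simp
  sub_eq_add_neg _ _ := by ext <;> simp <;> ring
  mul_assoc _ _ _ := by ext <;> simp <;> ring
  one_mul _ := by ext <;> simp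
  mul_one _ := by ext <;> simp
  mul_comm _ _ := by ext <;> simp <;> ring
  zero_mul _ := by ext <;> simp
  mul_zero _ := by ext <;> simp
  left_distrib _ _ _ := by ext <;> simp <;> ring
  right_distrib _ _ _ := by ext <;> simp <;> ring
  nsmul n x := n • x
  nsmul_zero _ := by ext <;> simp
  nsmul_succ _ _ := by ext <;> simp <;> ring
  zsmul n x := n • x
  zsmul_zero' _ := by ext <;> simp
  zsmul_succ' _ _ := by ext <;> simp <;> ring
  zsmul_neg' _ _ := by ext <;> simp [Int.negSucc_eq]; all_goals ring
  natCast_zero := by ext <;> simp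
  natCast_succ _ := by ext <;> simp
  intCast_ofNat _ := by ext <;> simp
  intCast_negSucc _ := by ext <;> simp [Int.negSucc_eq]

/-- The norm form of `ℤ[θ]`. -/
def norm (x : ZCbrtFive) : ℤ :=
  x.a ^ 3 + 5 * x.b ^ 3 + 25 * x.c ^ 3 - 15 * (x.a * x.b * x.c)

/-- The adjugate of `x`: the product of the two other conjugates of `x`. -/
def adj (x : ZCbrtFive) : ZCbrtFive :=
  ⟨x.a ^ 2 - 5 * (x.b * x.c), 5 * x.c ^ 2 - x.a * x.b, x.b ^ 2 - x.a * x.c⟩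

lemma norm_mul (x y : ZCbrtFive) : norm (x * y) = norm x * norm y := by
  simp only [norm, mul_a, mul_b, mul_c]; ring

lemma norm_neg (x : ZCbrtFive) : norm (-x) = -norm x := by
  simp only [norm, neg_a, neg_b, neg_c]; ring

lemma norm_intCast (n : ℤ) : norm n = n ^ 3 := by
  simp [norm]

lemma mul_adj (x : ZCbrtFive) : x * adj x = (norm x : ZCbrtFive) := by
  ext <;> simp only [adj, norm, mul_a, mul_b, mul_c, intCast_a, intCast_b, intCast_c] <;> ring

lemma norm_adj (x : ZCbrtFive) : norm (adj x) = norm x ^ 2 := by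
  simp only [norm, adj]; ring

lemma eq_zero_of_cubic (k : ℕ) (a b c : ℤ) (hk : a.natAbs + b.natAbs + c.natAbs = k)
    (h : a ^ 3 + 5 * b ^ 3 + 25 * c ^ 3 - 15 * (a * b * c) = 0) : k = 0 := by
  induction k using Nat.strong_induction_on generalizing a b c with
  | _ k ih =>
    have p5 : Prime (5 : ℤ) := by norm_num
    obtain ⟨a', rfl⟩ : 5 ∣ a := p5.dvd_of_dvd_pow (n := 3)
      ⟨-b ^ 3 - 5 * c ^ 3 + 3 * (a * b * c), by linarith⟩
    have h2 : b ^ 3 + 5 * c ^ 3 + 25 * a' ^ 3 - 15 * (b * c * a') = 0 := by linarith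
    by_contra hne
    have hlt : b.natAbs + c.natAbs + a'.natAbs < k ∨ a' = 0 := by omega
    rcases hlt with hlt | rfl
    · have := ih _ hlt b c a' rfl h2
      omega
    · obtain ⟨b', rfl⟩ : 5 ∣ b := p5.dvd_of_dvd_pow (n := 3) ⟨-c ^ 3, by linarith⟩
      have h3 : c ^ 3 + 5 * 0 ^ 3 + 25 * b' ^ 3 - 15 * (c * 0 * b') = 0 := by linarith
      have hlt : c.natAbs + (0 : ℤ).natAbs + b'.natAbs < k ∨ b' = 0 := by omega
      rcases hlt with hlt | rfl
      · have := ih _ hlt c 0 b' rfl h3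
        simp only [Int.natAbs_zero] at *
        omega
      · have : c = 0 := by
          have : c ^ 3 = 0 := by linarith
          exact pow_eq_zero_iff (by norm_num) |>.1 this
        simp [this] at hk
        omega

lemma norm_eq_zero {x : ZCbrtFive} : norm x = 0 ↔ x = 0 := by
  refine ⟨fun h => ?_, fun h => by subst h; simp [norm]⟩
  have := eq_zero_of_cubic _ x.a x.b x.c rfl h
  ext <;> simp <;> omega

/-! ### A two-stage Euclidean algorithm -/

/-- Each entry `(k, q)` stands for the Euclidean step taking `(u, v)` to the remainder
`u - k v` if `q = 0`, and to `q (u - k v) - v` otherwise. -/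
def euclidSteps : List (ZCbrtFive × ZCbrtFive) :=
  [(⟨0, 0, 0⟩, ⟨0, 0, 0⟩), (⟨-1, -1, 0⟩, ⟨-3, -2, -1⟩), (⟨0, 0, 1⟩, ⟨-3, -2, -1⟩),
    (⟨1, -1, 0⟩, ⟨-12, -7, -4⟩), (⟨-1, 1, 0⟩, ⟨12, 7, 4⟩), (⟨2, -1, 0⟩, ⟨-12, -7, -4⟩),
    (⟨1, 0, 0⟩, ⟨0, 0, 0⟩), (⟨-1, 0, 0⟩, ⟨0, 0, 0⟩), (⟨2, -1, 1⟩, ⟨-12, -7, -4⟩),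
    (⟨0, -1, 0⟩, ⟨-3, -2, -1⟩), (⟨0, 1, 0⟩, ⟨3, 2, 1⟩), (⟨-1, -1, 1⟩, ⟨-3, -2, -1⟩),
    (⟨-2, 1, 0⟩, ⟨12, 7, 4⟩), (⟨-2, 1, -1⟩, ⟨12, 7, 4⟩), (⟨-2, -1, 0⟩, ⟨-1, -1, 1⟩),
    (⟨-2, 2, 0⟩, ⟨-29, -17, -10⟩), (⟨0, 0, 0⟩, ⟨1, -1, 0⟩), (⟨3, -2, 0⟩, ⟨29, 17, 10⟩),
    (⟨2, 1, 1⟩, ⟨1, 1, -1⟩), (⟨-2, -1, -1⟩, ⟨-1, -1, 1⟩), (⟨-1, -1, 0⟩, ⟨0, 0, 0⟩),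
    (⟨0, 0, 0⟩, ⟨-3, -2, -1⟩), (⟨1, 1, 0⟩, ⟨0, 0, 0⟩), (⟨2, 1, 0⟩, ⟨1, 1, -1⟩),
    (⟨0, -1, 0⟩, ⟨0, 0, 0⟩), (⟨0, 1, 0⟩, ⟨0, 0, 0⟩), (⟨-3, 2, 0⟩, ⟨-29, -17, -10⟩)]

/-- The coefficient of `u` in the remainder of a Euclidean step. -/
def coeffLeft (s : ZCbrtFive × ZCbrtFive) : ZCbrtFive := if s.2 = 0 then 1 else s.2

/-- The coefficient of `v` in the remainder of a Euclidean step. -/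
def coeffRight (s : ZCbrtFive × ZCbrtFive) : ZCbrtFive :=
  if s.2 = 0 then -s.1 else -(s.1 * s.2 + 1)

/-- A sufficient condition for `|N (Q x + P)| < 1` to hold for all `x` in the box with centre
`z / 32` and half-width `h / 32`. -/
def SmallOn (Q P z : ZCbrtFive) (h : ℤ) : Prop :=
  let y := Q * z + (32 : ℤ) • P
  let g := adj y * Q
  let m := y * adj Q
  |norm y| + 3 * (|g.a| + 5 * |g.c| + 5 * |g.b|) * h
    + 3 * (6 * |m.a| + 10 * |m.b| + 30 * |m.c|) * h ^ 2 + 46 * |norm Q| * h ^ 3 < 32768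

instance (Q P z : ZCbrtFive) (h : ℤ) : Decidable (SmallOn Q P z h) := by
  unfold SmallOn; infer_instance

/-- Whether the box with centre `z / 32` and half-width `2 ^ e / 32`, cut into dyadic pieces,
is covered by the regions in which some step of `euclidSteps` decreases the norm. -/
def covered : ℕ → ZCbrtFive → Bool
  | 0, z => euclidSteps.any fun s => SmallOn (coeffLeft s) (coeffRight s) z 1
  | e + 1, z => (euclidSteps.any fun s => SmallOn (coeffLeft s) (coeffRight s) z (2 ^ (e + 1))) ||
      [(-1 : ℤ), 1].all fun i => [(-1 : ℤ), 1].all fun j => [(-1 : ℤ), 1].all fun k =>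
        covered e ⟨z.a + i * 2 ^ e, z.b + j * 2 ^ e, z.c + k * 2 ^ e⟩

lemma covered_unit_box : covered 4 0 = true := by decide +kernel

lemma norm_add (x y : ZCbrtFive) :
    norm (x + y) = norm x + 3 * (adj x * y).a + 3 * (x * adj y).a + norm y := by
  simp only [norm, adj, add_a, add_b, add_c, mul_a]; ring

lemma abs_add_five_mul_le (x y z u v w : ℤ) :
    |x * u + 5 * (y * v + z * w)| ≤ |x| * |u| + 5 * (|y| * |v|) + 5 * (|z| * |w|) := by
  rw [← abs_mul, ← abs_mul, ← abs_mul, abs_le]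
  constructor <;>
  linarith [neg_abs_le (x * u), neg_abs_le (y * v), neg_abs_le (z * w), le_abs_self (x * u),
    le_abs_self (y * v), le_abs_self (z * w)]

lemma abs_mul_a_le (x y : ZCbrtFive) {r s t : ℤ} (ha : |y.a| ≤ r) (hb : |y.b| ≤ s)
    (hc : |y.c| ≤ t) : |(x * y).a| ≤ |x.a| * r + 5 * (|x.c| * s) + 5 * (|x.b| * t) := by
  have := abs_add_five_mul_le x.a x.b x.c y.a y.c y.b
  have h1 := mul_le_mul_of_nonneg_left ha (abs_nonneg x.a)
  have h2 := mul_le_mul_of_nonneg_left hb (abs_nonneg x.c)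
  have h3 := mul_le_mul_of_nonneg_left hc (abs_nonneg x.b)
  rw [mul_a]
  linarith

lemma abs_mul_le_sq {x y r : ℤ} (hx : |x| ≤ r) (hy : |y| ≤ r) : |x * y| ≤ r ^ 2 := by
  rw [abs_mul, sq]
  exact mul_le_mul hx hy (abs_nonneg y) ((abs_nonneg x).trans hx)

lemma abs_adj_le {x : ZCbrtFive} {r : ℤ} (ha : |x.a| ≤ r) (hb : |x.b| ≤ r) (hc : |x.c| ≤ r) :
    |(adj x).a| ≤ 6 * r ^ 2 ∧ |(adj x).b| ≤ 6 * r ^ 2 ∧ |(adj x).c| ≤ 2 * r ^ 2 := by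
  have h1 := abs_le.1 (abs_mul_le_sq ha ha)
  have h2 := abs_le.1 (abs_mul_le_sq hb hb)
  have h3 := abs_le.1 (abs_mul_le_sq hc hc)
  have h4 := abs_le.1 (abs_mul_le_sq ha hb)
  have h5 := abs_le.1 (abs_mul_le_sq ha hc)
  have h6 := abs_le.1 (abs_mul_le_sq hb hc)
  simp only [adj, abs_le, sq] at *
  refine ⟨⟨?_, ?_⟩, ⟨?_, ?_⟩, ?_, ?_⟩ <;> linarith

lemma abs_norm_le {x : ZCbrtFive} {r : ℤ} (ha : |x.a| ≤ r) (hb : |x.b| ≤ r) (hc : |x.c| ≤ r) :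
    |norm x| ≤ 46 * r ^ 3 := by
  have hr : 0 ≤ r := (abs_nonneg _).trans ha
  have h3 {u v w : ℤ} (hu : |u| ≤ r) (hv : |v| ≤ r) (hw : |w| ≤ r) : |u * v * w| ≤ r ^ 3 := by
    rw [abs_mul, pow_succ]
    exact mul_le_mul (abs_mul_le_sq hu hv) hw (abs_nonneg w) (by positivity)
  have h1 := abs_le.1 (h3 ha ha ha)
  have h2 := abs_le.1 (h3 hb hb hb)
  have h4 := abs_le.1 (h3 hc hc hc)
  have h5 := abs_le.1 (h3 ha hb hc)
  simp only [norm, abs_le]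
  constructor <;> linarith

lemma SmallOn.abs_norm_lt {Q P z x : ZCbrtFive} {n h : ℤ} (hn : 0 < n) (H : SmallOn Q P z h)
    (ha : |32 * x.a - z.a * n| ≤ h * n) (hb : |32 * x.b - z.b * n| ≤ h * n)
    (hc : |32 * x.c - z.c * n| ≤ h * n) : |norm (Q * x + P * n)| < n ^ 3 := by
  unfold SmallOn at H
  extract_lets y g m at H
  set d : ZCbrtFive := ⟨32 * x.a - z.a * n, 32 * x.b - z.b * n, 32 * x.c - z.c * n⟩ with hd
  have key : 32768 * norm (Q * x + P * n) =
      n ^ 3 * norm y + 3 * n ^ 2 * (g * d).a + 3 * n * (m * adj d).a + norm Q * norm d := by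
    have h1 : ((32 : ℤ) : ZCbrtFive) * (Q * x + P * n) = n * y + Q * d := by
      ext <;> simp only [y, hd, mul_a, mul_b, mul_c, add_a, add_b, add_c, intCast_a, intCast_b,
        intCast_c, zsmul_a, zsmul_b, zsmul_c] <;> ring
    have h2 : norm (((32 : ℤ) : ZCbrtFive) * (Q * x + P * n)) =
        32768 * norm (Q * x + P * n) := by
      rw [norm_mul, norm_intCast]; norm_num
    have h3 : adj (n * y) * (Q * d) = ((n ^ 2 : ℤ) : ZCbrtFive) * (g * d) := by
      ext <;> simp only [g, adj, mul_a, mul_b, mul_c, intCast_a, intCast_b, intCast_c] <;> ring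
    have h4 : (n * y) * adj (Q * d) = (n : ZCbrtFive) * (m * adj d) := by
      ext <;> simp only [m, adj, mul_a, mul_b, mul_c, intCast_a, intCast_b, intCast_c] <;> ring
    rw [← h2, h1, norm_add, h3, h4, norm_mul, norm_mul, norm_intCast]
    simp only [mul_a (n : ZCbrtFive), mul_a ((n ^ 2 : ℤ) : ZCbrtFive), intCast_a, intCast_b,
      intCast_c]
    ring
  have hg := abs_mul_a_le g d ha hb hc
  obtain ⟨e1, e2, e3⟩ := abs_adj_le (x := d) ha hb hc
  have hm := abs_mul_a_le m (adj d) e1 e2 e3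
  have hN := mul_le_mul_of_nonneg_left (abs_norm_le (x := d) ha hb hc) (abs_nonneg (norm Q))
  have hlt := mul_lt_mul_of_pos_left H (pow_pos hn 3)
  have hg' := mul_le_mul_of_nonneg_left hg (by positivity : 0 ≤ 3 * n ^ 2)
  have hm' := mul_le_mul_of_nonneg_left hm (by positivity : 0 ≤ 3 * n)
  have tri : |32768 * norm (Q * x + P * n)| ≤ n ^ 3 * |norm y| + 3 * n ^ 2 * |(g * d).a|
      + 3 * n * |(m * adj d).a| + |norm Q| * |norm d| := by
    rw [key]
    refine (abs_add_le _ _).trans (add_le_add ((abs_add_le _ _).trans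
      (add_le_add ((abs_add_le _ _).trans (add_le_add ?_ ?_)) ?_)) ?_)
    · rw [abs_mul, abs_of_pos (pow_pos hn 3)]
    · rw [abs_mul, abs_of_pos (by positivity : 0 < 3 * n ^ 2)]
    · rw [abs_mul, abs_of_pos (by positivity : 0 < 3 * n)]
    · rw [abs_mul]
  rw [abs_mul, abs_of_pos (by norm_num : (0 : ℤ) < 32768)] at tri
  have : 32768 * |norm (Q * x + P * n)| < 32768 * n ^ 3 := by
    refine tri.trans_lt (lt_of_le_of_lt ?_ (hlt.trans_eq (mul_comm _ _)))
    calc _ ≤ _ := add_le_add (add_le_add (add_le_add le_rfl hg') hm') hN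
      _ = _ := by ring
  linarith

lemma exists_child {t z n h : ℤ} (H : |t - z * n| ≤ 2 * h * n) :
    ∃ i ∈ [(-1 : ℤ), 1], |t - (z + i * h) * n| ≤ h * n := by
  rw [abs_le] at H
  rcases le_total t (z * n) with hle | hle
  · exact ⟨-1, by simp, abs_le.2 ⟨by linarith, by linarith⟩⟩
  · exact ⟨1, by simp, abs_le.2 ⟨by linarith, by linarith⟩⟩

lemma exists_step_of_covered {n : ℤ} (hn : 0 < n) {x : ZCbrtFive} (e : ℕ) (z : ZCbrtFive)
    (H : covered e z = true) (ha : |32 * x.a - z.a * n| ≤ 2 ^ e * n)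
    (hb : |32 * x.b - z.b * n| ≤ 2 ^ e * n) (hc : |32 * x.c - z.c * n| ≤ 2 ^ e * n) :
    ∃ s ∈ euclidSteps, |norm (coeffLeft s * x + coeffRight s * n)| < n ^ 3 := by
  induction e generalizing z with
  | zero =>
    simp only [covered, List.any_eq_true, decide_eq_true_eq] at H
    obtain ⟨s, hs, h⟩ := H
    exact ⟨s, hs, h.abs_norm_lt hn (by simpa using ha) (by simpa using hb) (by simpa using hc)⟩
  | succ e ih =>
    simp only [covered, Bool.or_eq_true, List.any_eq_true, List.all_eq_true,
      decide_eq_true_eq] at H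
    rcases H with ⟨s, hs, h⟩ | H
    · exact ⟨s, hs, h.abs_norm_lt hn ha hb hc⟩
    · rw [pow_succ'] at ha hb hc
      obtain ⟨i, hi, ha⟩ := exists_child ha
      obtain ⟨j, hj, hb⟩ := exists_child hb
      obtain ⟨k, hk, hc⟩ := exists_child hc
      exact ih _ (H i hi j hj k hk) ha hb hc

lemma exists_abs_sub_mul_le (m : ℤ) {n : ℤ} (hn : 0 < n) : ∃ z : ℤ, |2 * (m - z * n)| ≤ n := by
  refine ⟨(2 * m + n) / (2 * n), abs_le.2 ?_⟩
  have h1 := Int.mul_ediv_add_emod (2 * m + n) (2 * n)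
  have h2 := Int.emod_nonneg (2 * m + n) (by omega : 2 * n ≠ 0)
  have h3 := Int.emod_lt_of_pos (2 * m + n) (by omega : 0 < 2 * n)
  constructor <;> nlinarith

lemma exists_step_of_norm_pos (u : ZCbrtFive) {v : ZCbrtFive} (hv : 0 < norm v) :
    ∃ s ∈ euclidSteps, ∃ z : ZCbrtFive,
      |norm (coeffLeft s * (u - z * v) + coeffRight s * v)| < |norm v| := by
  set n := norm v with hn
  obtain ⟨za, ha⟩ := exists_abs_sub_mul_le (u * adj v).a hv
  obtain ⟨zb, hb⟩ := exists_abs_sub_mul_le (u * adj v).b hv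
  obtain ⟨zc, hc⟩ := exists_abs_sub_mul_le (u * adj v).c hv
  set z : ZCbrtFive := ⟨za, zb, zc⟩
  have hx : (u - z * v) * adj v = u * adj v - z * n := by
    rw [sub_mul, mul_assoc, mul_adj]
  obtain ⟨s, hs, h⟩ := exists_step_of_covered hv (x := (u - z * v) * adj v) 4 0 covered_unit_box
    (by
      rw [hx, sub_a, mul_a z, abs_le]
      simp only [z, intCast_a, intCast_b, intCast_c, zero_a]
      rw [abs_le] at ha
      constructor <;> linarith)
    (by
      rw [hx, sub_b, mul_b z, abs_le]
      simp only [z, intCast_a, intCast_b, intCast_c, zero_b]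
      rw [abs_le] at hb
      constructor <;> linarith)
    (by
      rw [hx, sub_c, mul_c z, abs_le]
      simp only [z, intCast_a, intCast_b, intCast_c, zero_c]
      rw [abs_le] at hc
      constructor <;> linarith)
  refine ⟨s, hs, z, ?_⟩
  have e : coeffLeft s * ((u - z * v) * adj v) + coeffRight s * n =
      adj v * (coeffLeft s * (u - z * v) + coeffRight s * v) := by
    rw [← mul_adj]; ring
  rw [e, norm_mul, norm_adj, abs_mul, abs_of_pos (pow_pos hv 2), pow_succ n 2] at h
  rw [abs_of_pos hv]
  exact lt_of_mul_lt_mul_left h (by positivity)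

/-- Two-stage Euclidean division in `ℤ[θ]`. -/
lemma exists_euclidean_division (u : ZCbrtFive) {v : ZCbrtFive} (hv : v ≠ 0) :
    ∃ k : ZCbrtFive, (norm (u - k * v)).natAbs < (norm v).natAbs ∨
      ∃ q : ZCbrtFive, (norm (v - q * (u - k * v))).natAbs < (norm v).natAbs := by
  wlog hpos : 0 < norm v generalizing u v with H
  · have hneg : 0 < norm (-v) := by
      rw [norm_neg]
      have := mt norm_eq_zero.1 hv
      omega
    obtain ⟨k, h⟩ := H (-u) (neg_ne_zero.2 hv) hneg
    refine ⟨k, ?_⟩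
    rw [show -u - k * -v = -(u - k * v) by ring] at h
    simp only [norm_neg, Int.natAbs_neg] at h
    refine h.imp_right fun ⟨q, hq⟩ => ⟨q, ?_⟩
    rwa [show -v - q * -(u - k * v) = -(v - q * (u - k * v)) by ring, norm_neg,
      Int.natAbs_neg] at hq
  · obtain ⟨s, -, z, h⟩ := exists_step_of_norm_pos u hpos
    rw [Int.abs_eq_natAbs, Int.abs_eq_natAbs, Nat.cast_lt] at h
    refine ⟨z + s.1, ?_⟩
    by_cases hs : s.2 = 0
    · left
      convert h using 3
      simp only [coeffLeft, coeffRight, hs, if_true]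
      ring
    · right
      refine ⟨s.2, ?_⟩
      rw [← Int.natAbs_neg, ← norm_neg]
      convert h using 3
      simp only [coeffLeft, coeffRight, hs, if_false]
      ring

end ZCbrtFive

/-! ### Elementary matrices -/

section Elementary

variable {R : Type*} [CommRing R]

/-- The upper unitriangular matrix with off-diagonal entry `x`. -/
def upper (x : R) : Matrix.SpecialLinearGroup (Fin 2) R := ⟨!![1, x; 0, 1], by simp⟩

/-- The lower unitriangular matrix with off-diagonal entry `x`. -/
def lower (x : R) : Matrix.SpecialLinearGroup (Fin 2) R := ⟨!![1, 0; x, 1], by simp⟩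

/-- The Weyl element. -/
def weyl (R : Type*) [CommRing R] : Matrix.SpecialLinearGroup (Fin 2) R :=
  ⟨!![0, 1; -1, 0], by simp⟩

lemma coe_upper (x : R) : (upper x : Matrix (Fin 2) (Fin 2) R) = !![1, x; 0, 1] := rfl
lemma coe_lower (x : R) : (lower x : Matrix (Fin 2) (Fin 2) R) = !![1, 0; x, 1] := rfl
lemma coe_weyl : (weyl R : Matrix (Fin 2) (Fin 2) R) = !![0, 1; -1, 0] := rfl

lemma upper_add (x y : R) : upper (x + y) = upper x * upper y := by
  apply Subtype.ext
  simp [coe_upper, add_comm]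

lemma weyl_eq : weyl R = upper 1 * lower (-1) * upper 1 := by
  apply Subtype.ext
  simp [coe_upper, coe_lower, coe_weyl]

lemma weyl_mul_upper (x : R) : weyl R * upper x = lower (-x) * weyl R := by
  apply Subtype.ext
  simp [coe_upper, coe_lower, coe_weyl]

lemma weyl_pow_four : weyl R ^ 4 = 1 := by
  apply Subtype.ext
  simp [coe_weyl, pow_succ, Matrix.one_fin_two]

lemma mul_upper_mul_weyl_of_lower_left_eq_zero (g : Matrix.SpecialLinearGroup (Fin 2) R)
    (h : g 1 0 = 0) :
    g * upper (-(g 1 1 * g 0 1)) * weyl R = upper (g 0 0) * lower (-g 1 1) * upper (g 0 0) := by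
  have hdet := g.det_coe
  rw [Matrix.det_fin_two, h, mul_zero, sub_zero] at hdet
  apply Subtype.ext
  ext i j
  fin_cases i <;> fin_cases j <;>
    simp only [Matrix.SpecialLinearGroup.coe_mul, Matrix.mul_apply, Fin.sum_univ_two, coe_upper,
      coe_lower, coe_weyl] <;>
    simp [h]
  · linear_combination (1 + g 0 1) * hdet
  · linear_combination (-g 0 0) * hdet
  · linear_combination hdet

end Elementary

lemma ZCbrtFive.elementary_eq_top (H : Subgroup (Matrix.SpecialLinearGroup (Fin 2) ZCbrtFive))
    (hU : ∀ x, upper x ∈ H) (hL : ∀ x, lower x ∈ H) : H = ⊤ := by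
  have hw : weyl ZCbrtFive ∈ H := by
    rw [weyl_eq]
    exact H.mul_mem (H.mul_mem (hU _) (hL _)) (hU _)
  refine (Subgroup.eq_top_iff' H).2 fun g => ?_
  induction h : (norm (g 1 0)).natAbs using Nat.strong_induction_on generalizing g with
  | _ n ih =>
    by_cases h0 : g 1 0 = 0
    · have := mul_upper_mul_weyl_of_lower_left_eq_zero g h0
      rw [← H.mul_mem_cancel_right (hU (-(g 1 1 * g 0 1))), ← H.mul_mem_cancel_right hw, this]
      exact H.mul_mem (H.mul_mem (hU _) (hL _)) (hU _)
    · obtain ⟨k, hk | ⟨q, hq⟩⟩ := exists_euclidean_division (g 0 0) h0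
      · rw [← H.mul_mem_cancel_left (hU (-k)), ← H.mul_mem_cancel_left hw]
        refine ih _ ?_ _ rfl
        rw [← h]
        convert hk using 1
        rw [← Int.natAbs_neg, ← norm_neg]
        congr 2
        simp only [Matrix.SpecialLinearGroup.coe_mul, Matrix.mul_apply, Fin.sum_univ_two,
          coe_upper, coe_weyl]
        simp
        ring
      · rw [← H.mul_mem_cancel_left (hU (-k)), ← H.mul_mem_cancel_left (hL (-q))]
        refine ih _ ?_ _ rfl
        rw [← h]
        convert hq using 3
        simp only [Matrix.SpecialLinearGroup.coe_mul, Matrix.mul_apply, Fin.sum_univ_two,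
          coe_upper, coe_lower]
        simp
        ring

/-! ### The abelianization as a quotient of the additive group -/

section Abelianization

variable (R : Type*) [CommRing R]

/-- The class of an upper unitriangular matrix in the abelianization of `SL₂(R)`. -/
def upperClass : R →+ SL2ab R where
  toFun x := Additive.ofMul (Abelianization.of (upper x))
  map_zero' := by
    have : upper (0 : R) = 1 := by
      apply Subtype.ext
      simp [coe_upper, Matrix.one_fin_two]
    rw [this, map_one, ofMul_one]
  map_add' x y := by rw [upper_add, map_mul, ofMul_mul]

variable {R}

lemma ofMul_of_upper (x : R) :
    Additive.ofMul (Abelianization.of (upper x)) = upperClass R x := rfl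

lemma ofMul_of_lower (x : R) :
    Additive.ofMul (Abelianization.of (lower x)) = -upperClass R x := by
  have := congrArg (fun g => Additive.ofMul (Abelianization.of g)) (weyl_mul_upper (-x))
  simp only [map_mul, ofMul_mul, neg_neg, ofMul_of_upper, map_neg] at this
  rw [add_comm] at this
  exact (add_right_cancel this).symm

lemma ofMul_of_weyl :
    Additive.ofMul (Abelianization.of (weyl R)) = (3 : ℕ) • upperClass R 1 := by
  rw [weyl_eq]
  simp only [map_mul, ofMul_mul, ofMul_of_upper, ofMul_of_lower, map_neg]
  abel

lemma twelve_nsmul_upperClass_one : (12 : ℕ) • upperClass R 1 = 0 := by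
  have := congrArg (fun g => Additive.ofMul (Abelianization.of g)) (weyl_pow_four (R := R))
  simp only [map_pow, ofMul_pow, ofMul_of_weyl, map_one, ofMul_one, smul_smul] at this
  exact this

end Abelianization

namespace ZCbrtFive

/-- The cube root `θ` of `5`. -/
def theta : ZCbrtFive := ⟨0, 1, 0⟩

lemma weyl_relation :
    weyl _ * (upper (1 - theta) * weyl _) * (upper (-theta) * weyl _) =
      weyl _ * weyl _ * upper (2 + theta + theta ^ 2) * weyl _ * (upper (1 + theta) * weyl _) *
        (upper (2 - theta) * weyl _) * upper (-(3 + 2 * theta + theta ^ 2)) := by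
  decide +kernel

lemma weyl_relation_sq :
    weyl _ * (upper theta * weyl _) * (upper (2 * theta - theta ^ 2) * weyl _) =
      upper (-(5 + 3 * theta + 2 * theta ^ 2)) * weyl _ * (upper (2 - theta) * weyl _) *
        (upper (theta ^ 2) * weyl _) * upper (3 + 2 * theta + theta ^ 2) := by
  decide +kernel

lemma upperClass_ofNat (n : ℕ) [n.AtLeastTwo] :
    upperClass ZCbrtFive ofNat(n) = (n : ℤ) • upperClass ZCbrtFive 1 := by
  rw [← map_zsmul, zsmul_one, Int.cast_natCast]
  rfl

lemma upperClass_theta : upperClass ZCbrtFive theta = (5 : ℤ) • upperClass ZCbrtFive 1 := by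
  have h := congrArg (fun g => Additive.ofMul (Abelianization.of g)) weyl_relation
  have h12 := twelve_nsmul_upperClass_one (R := ZCbrtFive)
  simp only [map_mul, ofMul_mul, ofMul_of_upper, ofMul_of_weyl, map_neg, map_add, map_sub,
    two_mul, upperClass_ofNat] at h
  linear_combination (norm := module) (-1 : ℤ) • h - h12

lemma upperClass_theta_sq : upperClass ZCbrtFive (theta ^ 2) = upperClass ZCbrtFive 1 := by
  have h := congrArg (fun g => Additive.ofMul (Abelianization.of g)) weyl_relation_sq
  have h12 := twelve_nsmul_upperClass_one (R := ZCbrtFive)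
  have h3 : (3 : ZCbrtFive) * theta = theta + theta + theta := by ring
  simp only [map_mul, ofMul_mul, ofMul_of_upper, ofMul_of_weyl, map_neg, map_add, map_sub,
    two_mul, h3, upperClass_ofNat, upperClass_theta] at h
  linear_combination (norm := module) (-1 : ℤ) • h + (2 : ℤ) • h12

lemma upperClass_eq (x : ZCbrtFive) :
    upperClass ZCbrtFive x = (x.a + 5 * x.b + x.c) • upperClass ZCbrtFive 1 := by
  have hx : x = x.a • (1 : ZCbrtFive) + x.b • theta + x.c • theta ^ 2 := by
    ext <;> simp [theta, pow_two]
  conv_lhs => rw [hx]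
  rw [map_add, map_add, map_zsmul, map_zsmul, map_zsmul, upperClass_theta, upperClass_theta_sq]
  module

lemma mem_zmultiples_upperClass_one (g : SL2ab ZCbrtFive) :
    g ∈ AddSubgroup.zmultiples (upperClass ZCbrtFive 1) := by
  have hU (x : ZCbrtFive) : upperClass ZCbrtFive x ∈
      AddSubgroup.zmultiples (upperClass ZCbrtFive 1) :=
    AddSubgroup.mem_zmultiples_iff.2 ⟨_, (upperClass_eq x).symm⟩
  have hL (x : ZCbrtFive) : Additive.ofMul (Abelianization.of (lower x)) ∈
      AddSubgroup.zmultiples (upperClass ZCbrtFive 1) := by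
    rw [ofMul_of_lower]
    exact neg_mem (hU x)
  have key := elementary_eq_top
    ((AddSubgroup.toSubgroup' (AddSubgroup.zmultiples (upperClass ZCbrtFive 1))).comap
      Abelianization.of) hU hL
  obtain ⟨g, rfl⟩ : ∃ h, Additive.ofMul (Abelianization.of h) = g := QuotientGroup.mk_surjective g
  exact (Subgroup.eq_top_iff' _).1 key g

end ZCbrtFive

/-! ### The character of order `12` -/

/-- A polynomial expression for a character of `SL₂(ℤ/12)` taking the value `1` on `upper 1`. -/
def sl2Char {R : Type*} [CommRing R] (a b c d : R) : R :=
  (1 - c ^ 2) * (b * d + 3 * (c - 1) * d + c + 3) + c * (a + d - 3)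

lemma sl2Char_map {R S : Type*} [CommRing R] [CommRing S] (f : R →+* S) (a b c d : R) :
    f (sl2Char a b c d) = sl2Char (f a) (f b) (f c) (f d) := by
  simp only [sl2Char, map_add, map_sub, map_mul, map_pow, map_one, map_ofNat]

lemma sl2Char_mul_zmod_three : ∀ a b c d : ZMod 3, a * d - b * c = 1 →
    ∀ a' b' c' d' : ZMod 3, a' * d' - b' * c' = 1 →
      sl2Char (a * a' + b * c') (a * b' + b * d') (c * a' + d * c') (c * b' + d * d') =
        sl2Char a b c d + sl2Char a' b' c' d' := by
  decide +kernel

lemma sl2Char_mul_zmod_four : ∀ a b c d : ZMod 4, a * d - b * c = 1 →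
    ∀ a' b' c' d' : ZMod 4, a' * d' - b' * c' = 1 →
      sl2Char (a * a' + b * c') (a * b' + b * d') (c * a' + d * c') (c * b' + d * d') =
        sl2Char a b c d + sl2Char a' b' c' d' := by
  decide +kernel

lemma zmod_twelve_ext : ∀ x y : ZMod 12,
    ZMod.castHom (show 3 ∣ 12 by decide) (ZMod 3) x = ZMod.castHom (by decide) (ZMod 3) y →
    ZMod.castHom (show 4 ∣ 12 by decide) (ZMod 4) x = ZMod.castHom (by decide) (ZMod 4) y →
    x = y := by
  decide +kernel

lemma sl2Char_mul (a b c d a' b' c' d' : ZMod 12) (h : a * d - b * c = 1)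
    (h' : a' * d' - b' * c' = 1) :
    sl2Char (a * a' + b * c') (a * b' + b * d') (c * a' + d * c') (c * b' + d * d') =
      sl2Char a b c d + sl2Char a' b' c' d' := by
  apply zmod_twelve_ext
  · simp only [sl2Char_map, map_add, map_mul]
    apply sl2Char_mul_zmod_three
    · rw [← map_mul, ← map_mul, ← map_sub, h, map_one]
    · rw [← map_mul, ← map_mul, ← map_sub, h', map_one]
  · simp only [sl2Char_map, map_add, map_mul]
    apply sl2Char_mul_zmod_four
    · rw [← map_mul, ← map_mul, ← map_sub, h, map_one]
    · rw [← map_mul, ← map_mul, ← map_sub, h', map_one]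

/-- A character of `SL₂(ℤ/12)` taking the value `1` on `upper 1`. -/
def sl2CharHom : Matrix.SpecialLinearGroup (Fin 2) (ZMod 12) →* Multiplicative (ZMod 12) :=
  MonoidHom.mk' (fun g => Multiplicative.ofAdd (sl2Char (g 0 0) (g 0 1) (g 1 0) (g 1 1)))
    fun g h => by
      have hg := g.det_coe
      have hh := h.det_coe
      rw [Matrix.det_fin_two] at hg hh
      rw [← ofAdd_add, ← sl2Char_mul _ _ _ _ _ _ _ _ hg hh]
      simp only [Matrix.SpecialLinearGroup.coe_mul, Matrix.mul_apply, Fin.sum_univ_two]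

namespace ZCbrtFive

/-- The reduction `ℤ[θ] → ℤ/12` sending `θ` to `5`. -/
def toZModTwelve : ZCbrtFive →+* ZMod 12 where
  toFun x := x.a + 5 * x.b + x.c
  map_zero' := by simp
  map_one' := by simp
  map_add' x y := by simp; ring
  map_mul' x y := by
    have h : (24 : ZMod 12) = 0 := rfl
    simp only [mul_a, mul_b, mul_c]
    push_cast
    linear_combination (x.c * y.c - x.b * y.b : ZMod 12) * h

/-- The induced character on the abelianization of `SL₂(ℤ[θ])`. -/
def abelianizationChar : SL2ab ZCbrtFive →+ ZMod 12 :=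
  MonoidHom.toAdditiveLeft (Abelianization.lift
    (sl2CharHom.comp (Matrix.SpecialLinearGroup.map toZModTwelve)))

lemma abelianizationChar_upperClass_one :
    abelianizationChar (upperClass ZCbrtFive 1) = 1 := by
  decide +kernel

lemma bijective_abelianizationChar : Function.Bijective abelianizationChar := by
  constructor
  · rw [injective_iff_map_eq_zero]
    intro g hg
    obtain ⟨n, rfl⟩ := mem_zmultiples_upperClass_one g
    rw [map_zsmul, abelianizationChar_upperClass_one, zsmul_one,
      ZMod.intCast_zmod_eq_zero_iff_dvd] at hg
    obtain ⟨m, rfl⟩ := hg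
    have h := twelve_nsmul_upperClass_one (R := ZCbrtFive)
    rw [← natCast_zsmul] at h
    show (((12 : ℕ) : ℤ) * m) • upperClass ZCbrtFive 1 = 0
    rw [mul_comm, mul_smul, h, smul_zero]
  · intro x
    obtain ⟨n, rfl⟩ := ZMod.intCast_surjective x
    exact ⟨n • upperClass ZCbrtFive 1, by
      rw [map_zsmul, abelianizationChar_upperClass_one, zsmul_one]⟩

end ZCbrtFive

/-- A ring isomorphism induces an isomorphism of the abelianizations of `SL₂`. -/
def sl2abCongr {R S : Type*} [CommRing R] [CommRing S] (e : R ≃+* S) : SL2ab R ≃+ SL2ab S :=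
  MulEquiv.toAdditive <| MulEquiv.abelianizationCongr
    { Matrix.SpecialLinearGroup.map (n := Fin 2) (e : R →+* S) with
      invFun := Matrix.SpecialLinearGroup.map (e.symm : S →+* R)
      left_inv := fun g => by ext; simp
      right_inv := fun g => by ext; simp }

/-! ### Identification of the ring of integers -/

section RingOfIntegers

open Polynomial

variable {K : Type*} [Field K] [NumberField K]

lemma minpoly_eq_of_isEisensteinAt {β : K} {P : ℤ[X]} (hP : P.Monic) {p : ℤ} (hp : Prime p)
    (hE : P.IsEisensteinAt (Submodule.span ℤ {p})) (hd : 0 < P.natDegree)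
    (hβ : aeval β P = 0) : minpoly ℤ β = P := by
  have hirr : Irreducible P :=
    hE.irreducible ((Ideal.span_singleton_prime hp.ne_zero).2 hp) hP.isPrimitive hd
  have hQ := minpoly.eq_of_irreducible_of_monic (x := β)
    ((hP.irreducible_iff_irreducible_map_fraction_map (K := ℚ)).1 hirr)
    (by rwa [aeval_map_algebraMap]) (hP.map _)
  rw [minpoly.isIntegrallyClosed_eq_field_fractions' ℚ ⟨P, hP, hβ⟩] at hQ
  exact (map_injective _ (algebraMap ℤ ℚ).injective_int hQ).symm

lemma exists_powerBasis_gen_eq {β : K} (hint : IsIntegral ℤ β)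
    (hd : (minpoly ℤ β).natDegree = Module.finrank ℚ K) : ∃ B : PowerBasis ℚ K, B.gen = β := by
  have htop : IntermediateField.adjoin ℚ {β} = ⊤ := by
    rw [Field.primitive_element_iff_minpoly_natDegree_eq,
      minpoly.isIntegrallyClosed_eq_field_fractions' ℚ hint,
      (minpoly.monic hint).natDegree_map, hd]
  rw [IntermediateField.adjoin_eq_top_iff] at htop
  exact ⟨PowerBasis.ofAdjoinEqTop (IsIntegral.of_finite ℚ β) htop,
    PowerBasis.ofAdjoinEqTop_gen _ _⟩

lemma mem_adjoin_of_pow_smul_mem {β : K} {P : ℤ[X]} (hP : P.Monic) {p : ℤ} (hp : Prime p)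
    (hE : P.IsEisensteinAt (Submodule.span ℤ {p})) (hd : P.natDegree = Module.finrank ℚ K)
    (hβ : aeval β P = 0) {z : K} (hz : IsIntegral ℤ z) (n : ℕ)
    (h : p ^ n • z ∈ Algebra.adjoin ℤ {β}) : z ∈ Algebra.adjoin ℤ {β} := by
  have hmin := minpoly_eq_of_isEisensteinAt hP hp hE (hd ▸ Module.finrank_pos) hβ
  have hint : IsIntegral ℤ β := ⟨P, hP, hβ⟩
  obtain ⟨B, rfl⟩ := exists_powerBasis_gen_eq hint (hmin ▸ hd)
  exact mem_adjoin_of_smul_prime_pow_smul_of_minpoly_isEisensteinAt hp hint hz h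
    (hmin.symm ▸ hE)

lemma isEisensteinAt_cubic {p a b c : ℤ} (hp : Prime p) (ha : p ∣ a) (hb : p ∣ b) (hc : p ∣ c)
    (hc' : ¬p ^ 2 ∣ c) :
    (X ^ 3 + C a * X ^ 2 + C b * X + C c : ℤ[X]).IsEisensteinAt (Submodule.span ℤ {p}) := by
  have hd : (X ^ 3 + C a * X ^ 2 + C b * X + C c : ℤ[X]).natDegree = 3 := by compute_degree!
  refine ⟨?_, fun {n} hn => ?_, ?_⟩
  · have hm : (X ^ 3 + C a * X ^ 2 + C b * X + C c : ℤ[X]).Monic := by monicity!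
    exact hm.leadingCoeff_notMem ((Ideal.span_singleton_prime hp.ne_zero).2 hp).ne_top
  · rw [hd] at hn
    refine Ideal.mem_span_singleton.2 ?_
    interval_cases n <;>
      simpa only [coeff_add, coeff_C_mul, coeff_X_pow, coeff_X, coeff_C, OfNat.ofNat_ne_zero,
        OfNat.ofNat_ne_one, OfNat.one_ne_ofNat, Nat.reduceEqDiff, zero_ne_one, one_ne_zero, if_true,
        if_false, mul_zero, mul_one, zero_add, add_zero]
  · refine fun h => hc' ?_
    rw [← Ideal.mem_span_singleton, ← Ideal.span_singleton_pow]
    simpa using h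

lemma aeval_cubic {L : Type*} [CommRing L] (β : L) (a b c : ℤ) :
    aeval β (X ^ 3 + C a * X ^ 2 + C b * X + C c : ℤ[X]) = β ^ 3 + a * β ^ 2 + b * β + c := by
  simp

lemma mem_adjoin_of_cubic_of_pow_smul_mem (hdeg : Module.finrank ℚ K = 3) {β : K} {p a b c : ℤ}
    (hp : Prime p) (ha : p ∣ a) (hb : p ∣ b) (hc : p ∣ c) (hc' : ¬p ^ 2 ∣ c)
    (hβ : β ^ 3 + a * β ^ 2 + b * β + c = 0) {z : K} (hz : IsIntegral ℤ z) (n : ℕ)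
    (h : p ^ n • z ∈ Algebra.adjoin ℤ {β}) : z ∈ Algebra.adjoin ℤ {β} :=
  mem_adjoin_of_pow_smul_mem (P := X ^ 3 + C a * X ^ 2 + C b * X + C c) (by monicity!) hp
    (isEisensteinAt_cubic hp ha hb hc hc') (hdeg.symm ▸ by compute_degree!)
    (by rwa [aeval_cubic]) hz n h

variable {α : K}

lemma minpoly_cbrt_five (hα : α ^ 3 = 5) : minpoly ℤ α = X ^ 3 + C 0 * X ^ 2 + C 0 * X + C (-5) :=
  minpoly_eq_of_isEisensteinAt (by monicity!) (p := 5) (by norm_num)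
    (isEisensteinAt_cubic (by norm_num) (by norm_num) (by norm_num) (by norm_num) (by norm_num))
    (by
      rw [show (X ^ 3 + C 0 * X ^ 2 + C 0 * X + C (-5) : ℤ[X]).natDegree = 3 by compute_degree!]
      norm_num)
    ((aeval_cubic _ _ _ _).trans (by simp [hα]))

lemma norm_cbrt_five (hdeg : Module.finrank ℚ K = 3) (hα : α ^ 3 = 5) :
    Algebra.norm ℚ α = 5 := by
  have h : Algebra.norm ℚ α ^ 3 = 5 ^ 3 := by
    rw [← map_pow, hα]
    simpa [hdeg] using Algebra.norm_algebraMap (S := K) (5 : ℚ)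
  exact (Odd.strictMono_pow (by decide : Odd 3)).injective h

lemma smul_mem_adjoin_cbrt_five (hdeg : Module.finrank ℚ K = 3) (hα : α ^ 3 = 5) {z : K}
    (hz : IsIntegral ℤ z) : (5 : ℤ) ^ 2 • (3 : ℤ) ^ 3 • z ∈ Algebra.adjoin ℤ {α} := by
  have hmin := minpoly_cbrt_five hα
  have hnat : (minpoly ℤ α).natDegree = Module.finrank ℚ K := by
    rw [hmin, hdeg]
    compute_degree!
  have hint : IsIntegral ℤ α :=
    ⟨X ^ 3 + C 0 * X ^ 2 + C 0 * X + C (-5), by monicity!,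
      (aeval_cubic _ _ _ _).trans (by simp [hα])⟩
  have hN := norm_cbrt_five hdeg hα
  obtain ⟨B, rfl⟩ := exists_powerBasis_gen_eq hint hnat
  have h := Algebra.discr_mul_isIntegral_mem_adjoin ℚ hint hz
  have hder : aeval B.gen (minpoly ℚ B.gen).derivative = 3 * B.gen ^ 2 := by
    rw [minpoly.isIntegrallyClosed_eq_field_fractions' ℚ hint, hmin]
    norm_num
  have h3 : Algebra.norm ℚ (3 : K) = 3 ^ 3 := by
    simpa [hdeg] using Algebra.norm_algebraMap (S := K) (3 : ℚ)
  rw [Algebra.discr_powerBasis_eq_norm, hder, map_mul, map_pow, hN, h3, hdeg] at h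
  convert neg_mem h using 1
  rw [smul_smul, ← neg_smul, ← Int.cast_smul_eq_zsmul ℚ]
  norm_num

lemma mem_adjoin_cbrt_five (hdeg : Module.finrank ℚ K = 3) (hα : α ^ 3 = 5) {z : K}
    (hz : IsIntegral ℤ z) : z ∈ Algebra.adjoin ℤ {α} := by
  have h5 : (3 : ℤ) ^ 3 • z ∈ Algebra.adjoin ℤ {α} :=
    mem_adjoin_of_cubic_of_pow_smul_mem hdeg (p := 5) (a := 0) (b := 0) (c := -5) (by norm_num)
      (by norm_num) (by norm_num) (by norm_num) (by norm_num) (by simp [hα]) (hz.smul _) 2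
      (smul_mem_adjoin_cbrt_five hdeg hα hz)
  have hle : Algebra.adjoin ℤ {α} ≤ Algebra.adjoin ℤ {α + 1} :=
    Algebra.adjoin_le <| Set.singleton_subset_iff.2 <| by
      simpa using sub_mem (Algebra.self_mem_adjoin_singleton ℤ (α + 1)) (one_mem _)
  have hge : Algebra.adjoin ℤ {α + 1} ≤ Algebra.adjoin ℤ {α} :=
    Algebra.adjoin_le <| Set.singleton_subset_iff.2 <|
      add_mem (Algebra.self_mem_adjoin_singleton ℤ α) (one_mem _)
  refine hge (mem_adjoin_of_cubic_of_pow_smul_mem hdeg (p := 3) (a := -3) (b := 3) (c := -6)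
    (by norm_num) (by norm_num) (by norm_num) (by norm_num) (by norm_num) ?_ hz 3 (hle h5))
  push_cast
  linear_combination hα

namespace ZCbrtFive

/-- The ring homomorphism out of `ℤ[θ]` determined by a cube root of `5`. -/
def lift {R : Type*} [CommRing R] (r : R) (hr : r ^ 3 = 5) : ZCbrtFive →+* R where
  toFun x := x.a + x.b * r + x.c * r ^ 2
  map_zero' := by simp
  map_one' := by simp
  map_add' x y := by simp; ring
  map_mul' x y := by
    simp only [mul_a, mul_b, mul_c]
    push_cast
    linear_combination (-(x.b * y.c + x.c * y.b + x.c * y.c * r : R)) * hr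

lemma lift_theta {R : Type*} [CommRing R] (r : R) (hr : r ^ 3 = 5) : lift r hr theta = r := by
  simp [lift, theta]

lemma lift_injective {R : Type*} [CommRing R] [CharZero R] (r : R) (hr : r ^ 3 = 5) :
    Function.Injective (lift r hr) := by
  rw [injective_iff_map_eq_zero]
  intro x hx
  have h := congrArg (lift r hr) (mul_adj x)
  rw [map_mul, hx, zero_mul, map_intCast, eq_comm, Int.cast_eq_zero] at h
  exact norm_eq_zero.1 h

lemma lift_ringOfIntegers_surjective (hdeg : Module.finrank ℚ K = 3) (r : 𝓞 K) (hr : r ^ 3 = 5) :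
    Function.Surjective (lift r hr) := by
  intro z
  have hα : (r : K) ^ 3 = 5 := by
    rw [← map_pow, hr, map_ofNat]
  have hle : Algebra.adjoin ℤ {(r : K)} ≤
      subalgebraOfSubring ((algebraMap (𝓞 K) K).comp (lift r hr)).range :=
    Algebra.adjoin_le <| Set.singleton_subset_iff.2 ⟨theta, by simp [lift_theta]⟩
  obtain ⟨x, hx⟩ := hle (mem_adjoin_cbrt_five hdeg hα z.isIntegral_coe)
  exact ⟨x, RingOfIntegers.ext hx⟩

end ZCbrtFive

end RingOfIntegers

/-- for the ring of integers `ℤ[∛5]` of the cubic field `ℚ(∛5)`,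
the abelianization of `SL₂` is `ℤ/12`. -/
theorem sl2_abelianization_Z_cbrt_five
    (K : Type*) [Field K] [NumberField K]
    (hdeg : Module.finrank ℚ K = 3)
    (α : K) (hα : α ^ 3 = 5) :
    Nonempty (SL2ab (𝓞 K) ≃+ ZMod 12) := by
  have hint : IsIntegral ℤ α := IsIntegral.of_pow (n := 3) (by norm_num) <| by
    rw [hα]
    simpa using isIntegral_algebraMap (R := ℤ) (A := K) (x := 5)
  let r : 𝓞 K := ⟨α, hint⟩
  have hr : r ^ 3 = 5 := RingOfIntegers.ext ((map_pow (algebraMap (𝓞 K) K) r 3).trans hα)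
  let e : ZCbrtFive ≃+* 𝓞 K := RingEquiv.ofBijective (ZCbrtFive.lift r hr)
    ⟨ZCbrtFive.lift_injective r hr, ZCbrtFive.lift_ringOfIntegers_surjective hdeg r hr⟩
  exact ⟨(sl2abCongr e).symm.trans
    (AddEquiv.ofBijective _ ZCbrtFive.bijective_abelianizationChar)⟩
end

section
/- Let K = ℚ(√−2, √3) and let O_K = ℤ[(√−6 + √−2)/2] be its ring of integers. Then SL₂(O_K)^ab ≅ ℤ/6 ⊕ ℤ/6. -/
open NumberField

namespace QuarticOrder

/-- The ring `k[s, l]` with `s ^ 2 = 3` and `l ^ 2 = -(2 + s)`; the quadruple `⟨a, b, c, d⟩` stands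
for `a + b s + c l + d s l`. -/
@[ext]
structure Quartic (k : Type*) where
  a : k
  b : k
  c : k
  d : k

namespace Quartic

instance {k : Type*} [DecidableEq k] : DecidableEq (Quartic k) :=
  fun _ _ ↦ decidable_of_iff _ Quartic.ext_iff.symm

section smul
variable {k S : Type*} [SMul S k] (t : S) (x : Quartic k)
instance : SMul S (Quartic k) := ⟨fun t x ↦ ⟨t • x.a, t • x.b, t • x.c, t • x.d⟩⟩
@[simp] lemma smul_a : (t • x).a = t • x.a := rfl
@[simp] lemma smul_b : (t • x).b = t • x.b := rfl
@[simp] lemma smul_c : (t • x).c = t • x.c := rfl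
@[simp] lemma smul_d : (t • x).d = t • x.d := rfl
end smul

variable {k : Type*} [CommRing k]

instance : Zero (Quartic k) := ⟨⟨0, 0, 0, 0⟩⟩
instance : One (Quartic k) := ⟨⟨1, 0, 0, 0⟩⟩
instance : Add (Quartic k) := ⟨fun x y ↦ ⟨x.a + y.a, x.b + y.b, x.c + y.c, x.d + y.d⟩⟩
instance : Neg (Quartic k) := ⟨fun x ↦ ⟨-x.a, -x.b, -x.c, -x.d⟩⟩
instance : Sub (Quartic k) := ⟨fun x y ↦ ⟨x.a - y.a, x.b - y.b, x.c - y.c, x.d - y.d⟩⟩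
instance : Mul (Quartic k) := ⟨fun x y ↦
  ⟨x.a * y.a + 3 * x.b * y.b - 2 * x.c * y.c - 3 * x.c * y.d - 3 * x.d * y.c - 6 * x.d * y.d,
    x.a * y.b + x.b * y.a - x.c * y.c - 2 * x.c * y.d - 2 * x.d * y.c - 3 * x.d * y.d,
    x.a * y.c + x.c * y.a + 3 * x.b * y.d + 3 * x.d * y.b,
    x.a * y.d + x.d * y.a + x.b * y.c + x.c * y.b⟩⟩
instance : NatCast (Quartic k) := ⟨fun n ↦ ⟨n, 0, 0, 0⟩⟩
instance : IntCast (Quartic k) := ⟨fun n ↦ ⟨n, 0, 0, 0⟩⟩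
section coords
variable (x y : Quartic k) (n : ℕ) (m : ℤ)
@[simp] lemma zero_a : (0 : Quartic k).a = 0 := rfl
@[simp] lemma zero_b : (0 : Quartic k).b = 0 := rfl
@[simp] lemma zero_c : (0 : Quartic k).c = 0 := rfl
@[simp] lemma zero_d : (0 : Quartic k).d = 0 := rfl
@[simp] lemma one_a : (1 : Quartic k).a = 1 := rfl
@[simp] lemma one_b : (1 : Quartic k).b = 0 := rfl
@[simp] lemma one_c : (1 : Quartic k).c = 0 := rfl
@[simp] lemma one_d : (1 : Quartic k).d = 0 := rfl
@[simp] lemma add_a : (x + y).a = x.a + y.a := rfl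
@[simp] lemma add_b : (x + y).b = x.b + y.b := rfl
@[simp] lemma add_c : (x + y).c = x.c + y.c := rfl
@[simp] lemma add_d : (x + y).d = x.d + y.d := rfl
@[simp] lemma neg_a : (-x).a = -x.a := rfl
@[simp] lemma neg_b : (-x).b = -x.b := rfl
@[simp] lemma neg_c : (-x).c = -x.c := rfl
@[simp] lemma neg_d : (-x).d = -x.d := rfl
@[simp] lemma sub_a : (x - y).a = x.a - y.a := rfl
@[simp] lemma sub_b : (x - y).b = x.b - y.b := rfl
@[simp] lemma sub_c : (x - y).c = x.c - y.c := rfl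
@[simp] lemma sub_d : (x - y).d = x.d - y.d := rfl
@[simp] lemma mul_a : (x * y).a =
  x.a * y.a + 3 * x.b * y.b - 2 * x.c * y.c - 3 * x.c * y.d - 3 * x.d * y.c - 6 * x.d * y.d := rfl
@[simp] lemma mul_b : (x * y).b =
  x.a * y.b + x.b * y.a - x.c * y.c - 2 * x.c * y.d - 2 * x.d * y.c - 3 * x.d * y.d := rfl
@[simp] lemma mul_c : (x * y).c = x.a * y.c + x.c * y.a + 3 * x.b * y.d + 3 * x.d * y.b := rfl
@[simp] lemma mul_d : (x * y).d = x.a * y.d + x.d * y.a + x.b * y.c + x.c * y.b := rfl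
@[simp] lemma natCast_a : (n : Quartic k).a = n := rfl
@[simp] lemma natCast_b : (n : Quartic k).b = 0 := rfl
@[simp] lemma natCast_c : (n : Quartic k).c = 0 := rfl
@[simp] lemma natCast_d : (n : Quartic k).d = 0 := rfl
@[simp] lemma intCast_a : (m : Quartic k).a = m := rfl
@[simp] lemma intCast_b : (m : Quartic k).b = 0 := rfl
@[simp] lemma intCast_c : (m : Quartic k).c = 0 := rfl
@[simp] lemma intCast_d : (m : Quartic k).d = 0 := rfl
end coords

instance : CommRing (Quartic k) where
  add_assoc _ _ _ := by ext <;> simp <;> ring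
  zero_add _ := by ext <;> simp
  add_zero _ := by ext <;> simp
  add_comm _ _ := by ext <;> simp <;> ring
  left_distrib _ _ _ := by ext <;> simp <;> ring
  right_distrib _ _ _ := by ext <;> simp <;> ring
  zero_mul _ := by ext <;> simp
  mul_zero _ := by ext <;> simp
  mul_assoc _ _ _ := by ext <;> simp <;> ring
  mul_comm _ _ := by ext <;> simp <;> ring
  one_mul _ := by ext <;> simp
  mul_one _ := by ext <;> simp
  neg_add_cancel _ := by ext <;> simp
  sub_eq_add_neg _ _ := by ext <;> simp <;> ring
  nsmul n x := n • x
  nsmul_zero _ := by ext <;> simp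
  nsmul_succ _ _ := by ext <;> simp <;> ring
  zsmul n x := n • x
  zsmul_zero' _ := by ext <;> simp
  zsmul_succ' _ _ := by ext <;> simp <;> ring
  zsmul_neg' _ _ := by ext <;> simp <;> ring
  natCast_zero := by ext <;> simp
  natCast_succ _ := by ext <;> simp
  intCast_ofNat _ := by ext <;> simp
  intCast_negSucc _ := by ext <;> simp

@[simp] lemma ofNat_a (n : ℕ) [n.AtLeastTwo] : (ofNat(n) : Quartic k).a = ofNat(n) := rfl
@[simp] lemma ofNat_b (n : ℕ) [n.AtLeastTwo] : (ofNat(n) : Quartic k).b = 0 := rfl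
@[simp] lemma ofNat_c (n : ℕ) [n.AtLeastTwo] : (ofNat(n) : Quartic k).c = 0 := rfl
@[simp] lemma ofNat_d (n : ℕ) [n.AtLeastTwo] : (ofNat(n) : Quartic k).d = 0 := rfl

/-- The constant term of the relative norm to `k[s]`. -/
def P (x : Quartic k) : k :=
  x.a ^ 2 + 3 * x.b ^ 2 + 2 * x.c ^ 2 + 6 * x.c * x.d + 6 * x.d ^ 2

/-- The coefficient of `s` in the relative norm to `k[s]`. -/
def Q (x : Quartic k) : k :=
  2 * x.a * x.b + x.c ^ 2 + 4 * x.c * x.d + 3 * x.d ^ 2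

/-- The absolute norm. -/
def N : Quartic k →* k where
  toFun x := x.P ^ 2 - 3 * x.Q ^ 2
  map_one' := by simp [P, Q]
  map_mul' x y := by simp [P, Q]; ring

lemma N_def (x : Quartic k) : N x = x.P ^ 2 - 3 * x.Q ^ 2 := rfl

/-- The automorphism fixing `s` and negating `l`. -/
def σ : Quartic k →+* Quartic k where
  toFun x := ⟨x.a, x.b, -x.c, -x.d⟩
  map_one' := by ext <;> simp
  map_mul' x y := by ext <;> simp <;> ring
  map_zero' := by ext <;> simp
  map_add' x y := by ext <;> simp <;> ring

/-- The automorphism negating `s` and inverting `l`. -/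
def τ : Quartic k →+* Quartic k where
  toFun x := ⟨x.a, -x.b, -2 * x.c - 3 * x.d, x.c + 2 * x.d⟩
  map_one' := by ext <;> simp
  map_mul' x y := by ext <;> simp <;> ring
  map_zero' := by ext <;> simp
  map_add' x y := by ext <;> simp <;> ring

lemma mul_σ (x : Quartic k) : x * σ x = ⟨x.P, x.Q, 0, 0⟩ := by
  ext <;> simp [σ, P, Q] <;> ring

/-- The product of the three other conjugates. -/
def cof (x : Quartic k) : Quartic k := ⟨x.a, x.b, -x.c, -x.d⟩ * ⟨x.P, -x.Q, 0, 0⟩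

lemma mul_cof (x : Quartic k) : x * cof x = ⟨N x, 0, 0, 0⟩ := by
  ext <;> simp [cof, N, P, Q] <;> ring

lemma N_eq_add (x : Quartic k) : N x = (x.a ^ 2 - 3 * x.b ^ 2) ^ 2 + (x.c ^ 2 - 3 * x.d ^ 2) ^ 2 +
    ((2 * (x.a * x.c - 3 * x.b * x.d) + 3 * (x.a * x.d - x.b * x.c)) ^ 2
      + 3 * (x.a * x.d - x.b * x.c) ^ 2) := by
  simp [N, P, Q]; ring

end Quartic
open Quartic

lemma eq_zero_of_sq_eq_three_mul_sq {x y : ℚ} (h : x ^ 2 = 3 * y ^ 2) : x = 0 ∧ y = 0 := by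
  have hy : y = 0 := by
    by_contra hne
    apply (show Nat.Prime 3 by norm_num).irrational_sqrt
    refine ⟨|x / y|, ?_⟩
    symm
    rw [Real.sqrt_eq_iff_mul_self_eq (by norm_num) (by positivity)]
    have : (y : ℝ) ≠ 0 := by exact_mod_cast hne
    push_cast
    rw [abs_mul_abs_self]
    field_simp
    have := congrArg (Rat.cast (K := ℝ)) h
    push_cast at this ⊢
    linarith
  exact ⟨by simpa [hy] using h, hy⟩

lemma Quartic.eq_zero_of_N {x : Quartic ℚ} (h : N x = 0) : x = 0 := by
  rw [N_eq_add] at h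
  have h1 : (x.a ^ 2 - 3 * x.b ^ 2) ^ 2 = 0 := by
    refine le_antisymm ?_ (by positivity)
    rw [← h]
    nlinarith [sq_nonneg (x.c ^ 2 - 3 * x.d ^ 2), sq_nonneg (x.a * x.d - x.b * x.c),
      sq_nonneg (2 * (x.a * x.c - 3 * x.b * x.d) + 3 * (x.a * x.d - x.b * x.c))]
  have h2 : (x.c ^ 2 - 3 * x.d ^ 2) ^ 2 = 0 := by
    refine le_antisymm ?_ (by positivity)
    rw [← h]
    nlinarith [sq_nonneg (x.a ^ 2 - 3 * x.b ^ 2), sq_nonneg (x.a * x.d - x.b * x.c),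
      sq_nonneg (2 * (x.a * x.c - 3 * x.b * x.d) + 3 * (x.a * x.d - x.b * x.c))]
  rw [sq_eq_zero_iff, sub_eq_zero] at h1 h2
  obtain ⟨ha, hb⟩ := eq_zero_of_sq_eq_three_mul_sq h1
  obtain ⟨hc, hd⟩ := eq_zero_of_sq_eq_three_mul_sq h2
  ext <;> assumption

/-- The order `ℤ[s, l]`. -/
abbrev Ord : Type := Quartic ℤ

/-- Extension of scalars along a ring homomorphism. -/
def Quartic.map {k k' : Type*} [CommRing k] [CommRing k'] (f : k →+* k') :
    Quartic k →+* Quartic k' where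
  toFun x := ⟨f x.a, f x.b, f x.c, f x.d⟩
  map_one' := by ext <;> simp
  map_mul' x y := by ext <;> simp [map_ofNat]
  map_zero' := by ext <;> simp
  map_add' x y := by ext <;> simp

lemma N_nonneg (x : Ord) : 0 ≤ N x := by rw [N_eq_add]; positivity

lemma N_eq_zero {x : Ord} : N x = 0 ↔ x = 0 := by
  refine ⟨fun h ↦ ?_, fun h ↦ by simp [h, N, P, Q]⟩
  have : N (Quartic.map (Int.castRingHom ℚ) x) = 0 := by
    have := congrArg (Int.cast (R := ℚ)) h
    simp only [N, P, Q, Quartic.map] at this ⊢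
    simpa using this
  have := eq_zero_of_N this
  rw [Quartic.ext_iff] at this ⊢
  simpa [Quartic.map] using this

lemma N_le (x : Ord) : N x ≤ x.P ^ 2 := by
  rw [N_def]; nlinarith [sq_nonneg x.Q]

instance : NoZeroDivisors Ord where
  eq_zero_or_eq_zero_of_mul_eq_zero {x y} h := by
    have := congrArg N h
    rwa [map_mul, N_eq_zero.2 rfl, mul_eq_zero, N_eq_zero, N_eq_zero] at this

instance : Nontrivial Ord := ⟨0, 1, by decide⟩

instance : IsDomain Ord := NoZeroDivisors.to_isDomain _

lemma N_pos {x : Ord} (h : x ≠ 0) : 0 < N x :=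
  (N_nonneg x).lt_of_ne fun e ↦ h (N_eq_zero.1 e.symm)

lemma N_intCast (m : ℤ) : N (m : Ord) = m ^ 4 := by simp [N, P, Q]; ring

lemma N_cof (x : Ord) : N x * N (cof x) = N x ^ 4 := by
  rw [← map_mul, mul_cof, ← N_intCast]; rfl

/-- A candidate for the quotient `z / y`. -/
def quo (y z : Ord) : Ord :=
  let w := cof y * z
  let n := N y
  ⟨w.a / n, w.b / n, w.c / n, w.d / n⟩

/-- A computable sufficient test for divisibility. -/
def dvdB (y z : Ord) : Bool := decide (z = y * quo y z)

lemma isIntegral_of_ringHom {A B : Type*} [CommRing A] [CommRing B] (f : A →+* B) {x : A}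
    (h : IsIntegral ℤ x) : IsIntegral ℤ (f x) :=
  h.map f.toIntAlgHom

lemma exists_int_of_isIntegral_const {p : ℚ} (h : IsIntegral ℤ (⟨p, 0, 0, 0⟩ : Quartic ℚ)) :
    ∃ n : ℤ, (n : ℚ) = p := by
  let f : ℚ →+* Quartic ℚ :=
    { toFun := fun p ↦ ⟨p, 0, 0, 0⟩
      map_one' := rfl
      map_mul' := fun x y ↦ by ext <;> simp
      map_zero' := rfl
      map_add' := fun x y ↦ by ext <;> simp }
  have hf : Function.Injective f := fun x y h ↦ congrArg Quartic.a h
  have : IsIntegral ℤ p := (isIntegral_algHom_iff f.toIntAlgHom hf).1 h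
  simpa using IsIntegrallyClosed.isIntegral_iff.1 this

lemma isIntegral_s (k : Type*) [CommRing k] : IsIntegral ℤ (⟨0, 1, 0, 0⟩ : Quartic k) := by
  refine IsIntegral.of_pow (n := 2) two_pos ?_
  have : (⟨0, 1, 0, 0⟩ : Quartic k) ^ 2 = algebraMap ℤ (Quartic k) 3 := by
    rw [sq, eq_intCast]; ext <;> simp
  exact this ▸ isIntegral_algebraMap

lemma exists_int_of_isIntegral_quadratic {p q : ℚ} (h : IsIntegral ℤ (⟨p, q, 0, 0⟩ : Quartic ℚ)) :
    (∃ n : ℤ, (n : ℚ) = p) ∧ ∃ n : ℤ, (n : ℚ) = q := by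
  have ht := isIntegral_of_ringHom τ h
  obtain ⟨A, hA⟩ := exists_int_of_isIntegral_const (p := 2 * p) (by
    convert h.add ht using 1; ext <;> simp [τ]; ring)
  obtain ⟨B, hB⟩ := exists_int_of_isIntegral_const (p := 6 * q) (by
    convert (isIntegral_s ℚ).mul (h.sub ht) using 1; ext <;> simp [τ]; ring)
  obtain ⟨m, hm⟩ := exists_int_of_isIntegral_const (p := p ^ 2 - 3 * q ^ 2) (by
    convert h.mul ht using 1; ext <;> simp [τ] <;> ring)
  have h1 : B ^ 2 = 3 * (A ^ 2 - 4 * m) := by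
    have : (B : ℚ) ^ 2 = 3 * (A ^ 2 - 4 * m) := by rw [hA, hB, hm]; ring
    exact_mod_cast this
  obtain ⟨B, rfl⟩ : (3 : ℤ) ∣ B := Int.prime_three.dvd_of_dvd_pow ⟨_, h1⟩
  have h2 : A ^ 2 - 3 * B ^ 2 = 4 * m := by linarith
  have h3 := congrArg (Int.cast (R := ZMod 4)) h2
  have key : ∀ A B m : ZMod 4, A ^ 2 - 3 * B ^ 2 = 4 * m → 2 * A = 0 ∧ 2 * B = 0 := by decide
  have h4 := key A B m (by push_cast at h3; exact h3)
  obtain ⟨i, hi⟩ : (4 : ℤ) ∣ 2 * A :=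
    (ZMod.intCast_zmod_eq_zero_iff_dvd _ 4).1 (by exact_mod_cast h4.1)
  obtain ⟨j, hj⟩ : (4 : ℤ) ∣ 2 * B :=
    (ZMod.intCast_zmod_eq_zero_iff_dvd _ 4).1 (by exact_mod_cast h4.2)
  obtain rfl : A = 2 * i := by omega
  obtain rfl : B = 2 * j := by omega
  refine ⟨⟨i, ?_⟩, ⟨j, ?_⟩⟩
  · push_cast at hA; linarith
  · push_cast at hB; linarith

lemma exists_ord_of_isIntegral {x : Quartic ℚ} (h : IsIntegral ℤ x) :
    ∃ y : Ord, Quartic.map (Int.castRingHom ℚ) y = x := by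
  have hσ := isIntegral_of_ringHom σ h
  obtain ⟨⟨A, hA⟩, ⟨B, hB⟩⟩ := exists_int_of_isIntegral_quadratic
    (p := 2 * x.a) (q := 2 * x.b) (by
    convert h.add hσ using 1; ext <;> simp [σ] <;> ring)
  obtain ⟨⟨p, hp⟩, ⟨q, hq⟩⟩ := exists_int_of_isIntegral_quadratic (mul_σ x ▸ h.mul hσ)
  have hi : ∀ a b : ℤ, IsIntegral ℤ (⟨a, b, 0, 0⟩ : Quartic ℚ) := by
    intro a b
    convert (isIntegral_algebraMap (R := ℤ) (x := a)).add
      ((isIntegral_algebraMap (R := ℤ) (x := b)).mul (isIntegral_s ℚ)) using 1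
    ext <;> simp
  obtain ⟨⟨C, hC⟩, ⟨D, hD⟩⟩ := exists_int_of_isIntegral_quadratic
    (p := 2 * x.c) (q := 2 * x.d) (by
    refine IsIntegral.of_pow (n := 2) two_pos ?_
    have : (⟨2 * x.c, 2 * x.d, 0, 0⟩ : Quartic ℚ) ^ 2 = ⟨(2 : ℤ), (-1 : ℤ), 0, 0⟩ *
        (4 * ⟨p, q, 0, 0⟩ - ⟨A, B, 0, 0⟩ ^ 2) := by
      rw [hA, hB, hp, hq, sq, sq]; ext <;> simp [P, Q] <;> ring
    rw [this]
    refine (hi _ _).mul (IsIntegral.sub (IsIntegral.mul ?_ (hi _ _)) ((hi _ _).pow _))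
    exact isIntegral_algebraMap (R := ℤ) (x := 4))
  have h1 : A ^ 2 + 3 * B ^ 2 + 2 * C ^ 2 + 6 * C * D + 6 * D ^ 2 = 4 * p := by
    have : (A ^ 2 + 3 * B ^ 2 + 2 * C ^ 2 + 6 * C * D + 6 * D ^ 2 : ℚ) = 4 * p := by
      rw [hA, hB, hC, hD, hp, P]; ring
    exact_mod_cast this
  have h2 : 2 * A * B + C ^ 2 + 4 * C * D + 3 * D ^ 2 = 4 * q := by
    have : (2 * A * B + C ^ 2 + 4 * C * D + 3 * D ^ 2 : ℚ) = 4 * q := by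
      rw [hA, hB, hC, hD, hq, Q]; ring
    exact_mod_cast this
  have h3 := congrArg (Int.cast (R := ZMod 4)) h1
  have h4 := congrArg (Int.cast (R := ZMod 4)) h2
  have h0 : (4 : ZMod 4) = 0 := rfl
  push_cast at h3 h4
  simp only [h0, zero_mul, add_zero] at h3 h4
  have key : ∀ A B C D : ZMod 4, A ^ 2 + 3 * B ^ 2 + 2 * C ^ 2 + 6 * C * D + 6 * D ^ 2 = 0 →
      2 * A * B + C ^ 2 + 3 * D ^ 2 = 0 →
      2 * A = 0 ∧ 2 * B = 0 ∧ 2 * C = 0 ∧ 2 * D = 0 := by decide +kernel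
  obtain ⟨kA, kB, kC, kD⟩ := key A B C D h3 h4
  have hdiv : ∀ A : ℤ, 2 * (A : ZMod 4) = 0 → ∃ i : ℤ, (A : ℚ) = 2 * i := by
    intro A h
    obtain ⟨i, hi⟩ : (4 : ℤ) ∣ 2 * A :=
      (ZMod.intCast_zmod_eq_zero_iff_dvd _ 4).1 (by exact_mod_cast h)
    obtain rfl : A = 2 * i := by omega
    exact ⟨i, by push_cast; rfl⟩
  obtain ⟨i, hi⟩ := hdiv A kA
  obtain ⟨j, hj⟩ := hdiv B kB
  obtain ⟨k, hk⟩ := hdiv C kC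
  obtain ⟨m, hm⟩ := hdiv D kD
  refine ⟨⟨i, j, k, m⟩, ?_⟩
  ext <;> simp [Quartic.map] <;> linarith

lemma ord_isIntegral (x : Ord) : IsIntegral ℤ x := by
  have hs := isIntegral_s ℤ
  have hl : IsIntegral ℤ (⟨0, 0, 1, 0⟩ : Ord) := by
    refine IsIntegral.of_pow (n := 2) two_pos ?_
    have : (⟨0, 0, 1, 0⟩ : Ord) ^ 2 = algebraMap ℤ Ord (-2) - ⟨0, 1, 0, 0⟩ := by decide
    exact this ▸ isIntegral_algebraMap.sub hs
  have : x = algebraMap ℤ Ord x.a + algebraMap ℤ Ord x.b * ⟨0, 1, 0, 0⟩ +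
      (algebraMap ℤ Ord x.c + algebraMap ℤ Ord x.d * ⟨0, 1, 0, 0⟩) * ⟨0, 0, 1, 0⟩ := by
    ext <;> simp
  rw [this]
  exact (isIntegral_algebraMap.add (isIntegral_algebraMap.mul hs)).add
    ((isIntegral_algebraMap.add (isIntegral_algebraMap.mul hs)).mul hl)

section
variable {K : Type*} [Field K] [NumberField K] {a b : K}

/-- The embedding with `s ↦ b` and `l ↦ a (1 + b) / 2`. -/
def quarticHom (ha : a ^ 2 = -2) (hb : b ^ 2 = 3) : Quartic ℚ →+* K where
  toFun x := x.a + x.b * b + (x.c + x.d * b) * (a * (1 + b) / 2)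
  map_one' := by simp
  map_zero' := by simp
  map_add' x y := by simp; ring
  map_mul' x y := by
    have hl : (a * (1 + b) / 2) ^ 2 = -(2 + b) := by
      rw [div_pow, mul_pow, ha]; linear_combination (-1 / 2) * hb
    generalize a * (1 + b) / 2 = l at hl
    simp
    linear_combination (x.c * y.d + y.c * x.d - x.b * y.b - (x.b * y.d + x.d * y.b) * l -
      x.d * y.d * l ^ 2 : K) * hb -
      (x.c * y.c + (x.c * y.d + x.d * y.c) * b + 3 * x.d * y.d : K) * hl

lemma quarticHom_injective (ha : a ^ 2 = -2) (hb : b ^ 2 = 3) :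
    Function.Injective (quarticHom ha hb) := by
  rw [injective_iff_map_eq_zero]
  intro x hx
  apply eq_zero_of_N
  have h := congrArg (quarticHom ha hb) (mul_cof x)
  rw [map_mul, hx, zero_mul] at h
  simpa [quarticHom] using h.symm

lemma quarticHom_surjective (hdeg : Module.finrank ℚ K = 4) (ha : a ^ 2 = -2) (hb : b ^ 2 = 3) :
    Function.Surjective (quarticHom ha hb) := by
  let f : (Fin 4 → ℚ) →ₗ[ℚ] K :=
    { toFun := fun v ↦ quarticHom ha hb ⟨v 0, v 1, v 2, v 3⟩
      map_add' := fun v w ↦ by rw [← map_add]; rfl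
      map_smul' := fun r v ↦ by
        simp [quarticHom, Algebra.smul_def]; ring }
  have hf : Function.Injective f := by
    intro v w h
    have := quarticHom_injective ha hb h
    rw [Quartic.ext_iff] at this
    ext i; fin_cases i <;> simp_all
  intro y
  obtain ⟨v, hv⟩ := (LinearMap.injective_iff_surjective_of_finrank_eq_finrank
    (by rw [hdeg, Module.finrank_fin_fun])).1 hf y
  exact ⟨_, hv⟩

/-- The ring of integers of `ℚ(√-2, √3)` is `ℤ[s, l]`. -/
theorem nonempty_ringOfIntegers_equiv (hdeg : Module.finrank ℚ K = 4)
    (ha : a ^ 2 = -2) (hb : b ^ 2 = 3) : Nonempty (𝓞 K ≃+* Ord) := by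
  let ψ : Ord →+* K := (quarticHom ha hb).comp (Quartic.map (Int.castRingHom ℚ))
  let : Algebra Ord K := ψ.toAlgebra
  have hψ : Function.Injective ψ := by
    refine (quarticHom_injective ha hb).comp fun x y h ↦ ?_
    rw [Quartic.ext_iff] at h ⊢
    simpa [Quartic.map] using h
  have : IsIntegralClosure Ord ℤ K :=
    { algebraMap_injective := hψ
      isIntegral_iff := fun {x} ↦ by
        constructor
        · intro hx
          obtain ⟨z, rfl⟩ := quarticHom_surjective hdeg ha hb x
          obtain ⟨y, rfl⟩ := exists_ord_of_isIntegral <|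
            (isIntegral_algHom_iff (quarticHom ha hb).toIntAlgHom (quarticHom_injective ha hb)).1 hx
          exact ⟨y, rfl⟩
        · rintro ⟨y, rfl⟩
          exact isIntegral_of_ringHom ψ (ord_isIntegral y) }
  exact ⟨NumberField.RingOfIntegers.equiv Ord⟩
end

open Matrix

/-- Upper unitriangular matrices. -/
def upper {R : Type*} [CommRing R] (t : R) : Matrix.SpecialLinearGroup (Fin 2) R :=
  ⟨!![1, t; 0, 1], by simp [det_fin_two]⟩

/-- Lower unitriangular matrices. -/
def lower {R : Type*} [CommRing R] (t : R) : Matrix.SpecialLinearGroup (Fin 2) R :=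
  ⟨!![1, 0; t, 1], by simp [det_fin_two]⟩

/-- The elementary subgroup of `SL₂(R)`. -/
def elementary (R : Type*) [CommRing R] : Subgroup (Matrix.SpecialLinearGroup (Fin 2) R) :=
  Subgroup.closure (Set.range upper ∪ Set.range lower)

section
variable {R : Type*} [CommRing R]

@[simp] lemma coe_upper (t : R) : (upper t).1 = !![1, t; 0, 1] := rfl

@[simp] lemma coe_lower (t : R) : (lower t).1 = !![1, 0; t, 1] := rfl

lemma upper_mem (t : R) : upper t ∈ elementary R := Subgroup.subset_closure (.inl ⟨t, rfl⟩)

lemma lower_mem (t : R) : lower t ∈ elementary R := Subgroup.subset_closure (.inr ⟨t, rfl⟩)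

lemma upper_add (t u : R) : upper (t + u) = upper t * upper u := by
  apply Subtype.ext
  simp [Matrix.SpecialLinearGroup.coe_mul, add_comm]

lemma upper_zero : upper (0 : R) = 1 := by
  apply Subtype.ext
  simp [one_fin_two]

lemma upper_neg (t : R) : upper (-t) = (upper t)⁻¹ := by
  rw [eq_inv_iff_mul_eq_one, ← upper_add, neg_add_cancel, upper_zero]

/-- The Weyl element. -/
def weyl (R : Type*) [CommRing R] : Matrix.SpecialLinearGroup (Fin 2) R :=
  ⟨!![0, 1; -1, 0], by simp [det_fin_two]⟩

@[simp] lemma coe_weyl : (weyl R).1 = !![0, 1; -1, 0] := rfl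

lemma weyl_eq : weyl R = upper 1 * lower (-1) * upper 1 := by
  apply Subtype.ext
  simp [Matrix.SpecialLinearGroup.coe_mul]

lemma weyl_mem : weyl R ∈ elementary R :=
  weyl_eq (R := R) ▸ mul_mem (mul_mem (upper_mem _) (lower_mem _)) (upper_mem _)

lemma lower_eq (t : R) : lower t = weyl R * upper (-t) * (weyl R)⁻¹ := by
  rw [eq_mul_inv_iff_mul_eq]
  apply Subtype.ext
  simp [Matrix.SpecialLinearGroup.coe_mul]

/-- The diagonal element attached to a pair of mutually inverse elements. -/
def diag {u v : R} (h : u * v = 1) : Matrix.SpecialLinearGroup (Fin 2) R :=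
  ⟨!![u, 0; 0, v], by simp [det_fin_two, h]⟩

@[simp] lemma coe_diag {u v : R} (h : u * v = 1) : (diag h).1 = !![u, 0; 0, v] := rfl

lemma diag_mem {u v : R} (h : u * v = 1) : diag h ∈ elementary R := by
  have : diag h = upper u * lower (-v) * upper u * (weyl R)⁻¹ := by
    rw [eq_mul_inv_iff_mul_eq]
    apply Subtype.ext
    simp [Matrix.SpecialLinearGroup.coe_mul, h, mul_comm v u]
  rw [this]
  exact mul_mem (mul_mem (mul_mem (upper_mem _) (lower_mem _)) (upper_mem _)) (inv_mem weyl_mem)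

lemma mem_elementary_of_isUnit {M : Matrix.SpecialLinearGroup (Fin 2) R} (h : IsUnit (M 0 0)) :
    M ∈ elementary R := by
  obtain ⟨v, hv⟩ := h.exists_right_inv
  have hd := M.det_coe
  rw [det_fin_two] at hd
  have : M = lower (M 1 0 * v) * diag hv * upper (v * M 0 1) := by
    apply Subtype.ext
    simp only [Matrix.SpecialLinearGroup.coe_mul, coe_lower, coe_diag, coe_upper]
    ext1 i j
    fin_cases i <;> fin_cases j <;> simp
    · linear_combination (-M 0 1) * hv
    · linear_combination (-M 1 0) * hv
    · linear_combination (-M 1 1 - v * M 1 0 * M 0 1) * hv + v * hd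
  rw [this]
  exact mul_mem (mul_mem (lower_mem _) (diag_mem _)) (upper_mem _)

lemma mem_elementary_of_isUnit_sub {M : Matrix.SpecialLinearGroup (Fin 2) R} (k : R)
    (h : IsUnit (M 0 0 - k * M 1 0)) : M ∈ elementary R := by
  refine ((elementary R).mul_mem_cancel_left (upper_mem (-k))).1 (mem_elementary_of_isUnit ?_)
  convert h using 1
  simp [Matrix.SpecialLinearGroup.coe_mul, mul_apply, Fin.sum_univ_two]; ring

lemma mem_elementary_of_isUnit_sub_sub {M : Matrix.SpecialLinearGroup (Fin 2) R} (k m : R)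
    (h : IsUnit (M 1 0 - m * (M 0 0 - k * M 1 0))) : M ∈ elementary R := by
  refine ((elementary R).mul_mem_cancel_left (mul_mem weyl_mem (mul_mem (lower_mem (-m))
    (upper_mem (-k))))).1 (mem_elementary_of_isUnit ?_)
  convert h using 1
  simp [Matrix.SpecialLinearGroup.coe_mul, mul_apply, Fin.sum_univ_two]; ring

lemma upper_mulVec (t x y : R) : (upper t).1 *ᵥ ![x, y] = ![x + t * y, y] := by
  ext1 i; fin_cases i <;> simp [mulVec, dotProduct]

lemma weyl_inv_mulVec (x y : R) : ((weyl R)⁻¹).1 *ᵥ ![x, y] = ![-y, x] := by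
  rw [Matrix.SpecialLinearGroup.coe_inv, coe_weyl, adjugate_fin_two]
  ext1 i; fin_cases i <;> simp [mulVec, dotProduct]

lemma diag_mulVec {u v : R} (h : u * v = 1) (x y : R) :
    (diag h).1 *ᵥ ![x, y] = ![u * x, v * y] := by
  ext1 i; fin_cases i <;> simp [mulVec, dotProduct]

end

/-- A matrix of determinant `1 + s` normalizing the elementary subgroup. -/
def swap : Matrix (Fin 2) (Fin 2) Ord :=
  !![⟨1, 0, 1, 0⟩, ⟨0, 0, 1, -1⟩; ⟨1, 1, 0, 0⟩, ⟨-1, 0, -1, 0⟩]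

/-- The determinant of `swap`. -/
def β : Ord := ⟨1, 1, 0, 0⟩

lemma swap_mul_swap : swap * swap = -(β • (1 : Matrix (Fin 2) (Fin 2) Ord)) := by decide +kernel

lemma det_swap : swap.det = β := by rw [det_fin_two]; decide +kernel

/-- The elements whose conjugate by `swap` is elementary. -/
def swapNormal : Subgroup (Matrix.SpecialLinearGroup (Fin 2) Ord) where
  carrier := {e | ∃ e' ∈ elementary Ord, swap * e.1 = e'.1 * swap}
  one_mem' := ⟨1, one_mem _, by simp⟩
  mul_mem' := by
    rintro x y ⟨x', hx', hx⟩ ⟨y', hy', hy⟩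
    refine ⟨x' * y', mul_mem hx' hy', ?_⟩
    simp only [Matrix.SpecialLinearGroup.coe_mul]
    rw [← Matrix.mul_assoc, hx, Matrix.mul_assoc, hy, Matrix.mul_assoc]
  inv_mem' := by
    rintro x ⟨x', hx', hx⟩
    refine ⟨x'⁻¹, inv_mem hx', ?_⟩
    have h1 : x.1 * (x⁻¹).1 = 1 := by
      rw [← Matrix.SpecialLinearGroup.coe_mul, mul_inv_cancel]; rfl
    have h2 : (x'⁻¹).1 * x'.1 = 1 := by
      rw [← Matrix.SpecialLinearGroup.coe_mul, inv_mul_cancel]; rfl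
    calc swap * (x⁻¹).1 = (x'⁻¹).1 * x'.1 * swap * (x⁻¹).1 := by rw [h2, Matrix.one_mul]
      _ = (x'⁻¹).1 * (swap * x.1) * (x⁻¹).1 := by rw [hx, Matrix.mul_assoc (x'⁻¹).1]
      _ = (x'⁻¹).1 * swap := by rw [Matrix.mul_assoc, Matrix.mul_assoc swap, h1, Matrix.mul_one]

lemma upper_mem_swapNormal (t : Ord) : upper t ∈ swapNormal := by
  let T : AddSubgroup Ord :=
    { carrier := {t | upper t ∈ swapNormal}
      zero_mem' := by simp only [Set.mem_ofPred_eq, upper_zero, one_mem]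
      add_mem' := fun {x y} hx hy ↦ by
        simp only [Set.mem_ofPred_eq, upper_add] at *; exact mul_mem hx hy
      neg_mem' := fun {x} hx ↦ by
        simp only [Set.mem_ofPred_eq, upper_neg] at *; exact inv_mem hx }
  have h1 : (⟨1, 0, 0, 0⟩ : Ord) ∈ T := by
    refine ⟨⟨!![⟨0, 0, -1, 0⟩, ⟨-1, 0, -1, 1⟩; ⟨-1, -1, 0, 0⟩, ⟨2, 0, 1, 0⟩], ?_⟩,
      mem_elementary_of_isUnit_sub 0 (.of_mul_eq_one ⟨0, 0, 2, -1⟩ ?_), ?_⟩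
    · rw [det_fin_two]; decide +kernel
    · decide +kernel
    · decide +kernel
  have hl : (⟨0, 0, 1, 0⟩ : Ord) ∈ T := by
    refine ⟨⟨!![⟨3, 1, -1, 0⟩, ⟨-1, -1, -1, 0⟩; ⟨0, 0, -1, -1⟩, ⟨-1, -1, 1, 0⟩], ?_⟩,
      mem_elementary_of_isUnit_sub ⟨0, 0, -3, 2⟩ (.of_mul_eq_one ⟨0, 0, 2, -1⟩ ?_), ?_⟩
    · rw [det_fin_two]; decide +kernel
    · decide +kernel
    · decide +kernel
  have hl2 : (⟨-2, -1, 0, 0⟩ : Ord) ∈ T := by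
    refine ⟨⟨!![⟨3, 1, 2, 1⟩, ⟨2, 1, -1, -1⟩; ⟨5, 3, 0, 0⟩, ⟨-1, -1, -2, -1⟩], ?_⟩,
      mem_elementary_of_isUnit_sub ⟨-3, 2, 0, 0⟩ (.of_mul_eq_one ⟨0, 0, -7, 4⟩ ?_), ?_⟩
    · rw [det_fin_two]; decide +kernel
    · decide +kernel
    · decide +kernel
  have hl' : (⟨0, 0, -2, 1⟩ : Ord) ∈ T := by
    refine ⟨⟨!![⟨0, 0, 2, -1⟩, ⟨-1, 1, 2, -1⟩; ⟨0, 0, -1, 1⟩, ⟨2, 0, -2, 1⟩], ?_⟩,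
      mem_elementary_of_isUnit_sub 0 (.of_mul_eq_one ⟨0, 0, -1, 0⟩ ?_), ?_⟩
    · rw [det_fin_two]; decide +kernel
    · decide +kernel
    · decide +kernel
  have : t = (t.a - 2 * t.b) • ⟨1, 0, 0, 0⟩ + (t.c + 2 * t.d) • ⟨0, 0, 1, 0⟩ +
      (-t.b) • ⟨-2, -1, 0, 0⟩ + t.d • ⟨0, 0, -2, 1⟩ := by
    ext <;> simp <;> ring
  change t ∈ T
  rw [this]
  exact add_mem (add_mem (add_mem (zsmul_mem h1 _) (zsmul_mem hl _)) (zsmul_mem hl2 _))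
    (zsmul_mem hl' _)

lemma elementary_le_swapNormal : elementary Ord ≤ swapNormal := by
  have hw : weyl Ord ∈ swapNormal := by
    refine ⟨⟨!![⟨0, 0, -3, 1⟩, ⟨0, -1, -1, 1⟩; ⟨0, -1, 1, -1⟩, ⟨0, 0, 3, -1⟩], ?_⟩,
      mem_elementary_of_isUnit_sub_sub ⟨-1, 0, 0, 1⟩ ⟨2, -1, 0, 0⟩
        (.of_mul_eq_one ⟨0, 0, 2, -1⟩ ?_), ?_⟩
    · rw [det_fin_two]; decide +kernel
    · decide +kernel
    · decide +kernel
  rw [elementary, Subgroup.closure_le]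
  rintro _ (⟨t, rfl⟩ | ⟨t, rfl⟩)
  · exact upper_mem_swapNormal t
  · simp only [SetLike.mem_coe, lower_eq]
    exact mul_mem (mul_mem hw (upper_mem_swapNormal _)) (inv_mem hw)

/-- A column vector whose second coordinate can be cleared by an elementary matrix. -/
def Elim (v : Fin 2 → Ord) : Prop := ∃ e ∈ elementary Ord, (e.1 *ᵥ v) 1 = 0

/-- A column vector whose second coordinate can be cleared by an elementary matrix, possibly after
an application of `swap`. -/
def Red (v : Fin 2 → Ord) : Prop := Elim v ∨ Elim (swap *ᵥ v)

lemma Elim.of_mulVec {e : Matrix.SpecialLinearGroup (Fin 2) Ord} (he : e ∈ elementary Ord)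
    {v : Fin 2 → Ord} (h : Elim (e.1 *ᵥ v)) : Elim v := by
  obtain ⟨g, hg, h⟩ := h
  exact ⟨g * e, mul_mem hg he, by rwa [mulVec_mulVec] at h⟩

lemma Elim.smul (c : Ord) {v : Fin 2 → Ord} (h : Elim v) : Elim (c • v) := by
  obtain ⟨g, hg, h⟩ := h
  exact ⟨g, hg, by rw [mulVec_smul, Pi.smul_apply, h, smul_zero]⟩

lemma Elim.of_smul {c : Ord} (hc : c ≠ 0) {v : Fin 2 → Ord} (h : Elim (c • v)) : Elim v := by
  obtain ⟨g, hg, h⟩ := h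
  rw [mulVec_smul, Pi.smul_apply, smul_eq_mul, mul_eq_zero, or_iff_right hc] at h
  exact ⟨g, hg, h⟩

lemma Red.of_mulVec {e : Matrix.SpecialLinearGroup (Fin 2) Ord} (he : e ∈ elementary Ord)
    {v : Fin 2 → Ord} (h : Red (e.1 *ᵥ v)) : Red v := by
  refine h.imp (.of_mulVec he) fun h ↦ ?_
  obtain ⟨g, hg, hge⟩ := elementary_le_swapNormal he
  rw [mulVec_mulVec, hge, ← mulVec_mulVec] at h
  exact h.of_mulVec hg

lemma β_ne_zero : β ≠ 0 := by decide

lemma Red.of_swap {v : Fin 2 → Ord} (h : Red (swap *ᵥ v)) : Red v := by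
  refine Or.symm (h.imp id fun h ↦ ?_)
  rw [mulVec_mulVec, swap_mul_swap, ← neg_smul, smul_mulVec, one_mulVec] at h
  exact h.of_smul (neg_ne_zero.2 β_ne_zero)

lemma Red.smul (c : Ord) {v : Fin 2 → Ord} (h : Red v) : Red (c • v) :=
  h.imp (.smul c) fun h ↦ by rw [mulVec_smul]; exact h.smul c

lemma Red.of_smul {c : Ord} (hc : c ≠ 0) {v : Fin 2 → Ord} (h : Red (c • v)) : Red v :=
  h.imp (.of_smul hc) fun h ↦ by rw [mulVec_smul] at h; exact h.of_smul hc

/-- An element `y` modulo which every element can be reduced. -/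
def Good (y : Ord) : Prop := ∀ x, Red ![x, y]

lemma good_zero : Good 0 := fun x ↦ .inl ⟨1, one_mem _, by simp⟩

lemma Red.of_sub_dvd {x x' y : Ord} (h : Red ![x', y]) (hd : y ∣ x - x') : Red ![x, y] := by
  obtain ⟨k, hk⟩ := hd
  refine .of_mulVec (upper_mem (-k)) ?_
  rw [upper_mulVec, show x + -k * y = x' by linear_combination hk]
  exact h

lemma Good.red_left {g : Ord} (h : Good g) (y : Ord) : Red ![g, y] := by
  refine .of_mulVec (inv_mem weyl_mem) ?_
  rw [weyl_inv_mulVec]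
  exact h (-y)

lemma good_one : Good 1 := fun _ ↦
  .of_sub_dvd (good_zero.red_left 1) (one_dvd _)

lemma Good.of_associated {g h : Ord} (hg : Good g) (ha : Associated g h) : Good h := by
  obtain ⟨u, rfl⟩ := ha
  intro x
  have huv : (↑u⁻¹ : Ord) * u = 1 := u.inv_mul
  refine .of_mulVec (diag_mem (u := (u : Ord)) (v := ↑u⁻¹) u.mul_inv) ?_
  rw [diag_mulVec, show (↑u⁻¹ : Ord) * (g * u) = g by linear_combination g * huv]
  exact hg (u * x)

lemma eq_mul_quo {y z : Ord} (h : dvdB y z) : z = y * quo y z := by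
  simpa [dvdB] using h

lemma dvd_of_dvdB {y z : Ord} (h : dvdB y z) : y ∣ z := ⟨_, eq_mul_quo h⟩

/-- Test whether `x` is zero or associated to an element of `G`. -/
def goodB (G : List Ord) (x : Ord) : Bool :=
  decide (x = 0) || G.any fun g ↦ dvdB g x && dvdB x g

lemma good_of_goodB {G : List Ord} (hG : ∀ g ∈ G, Good g) {x : Ord} (h : goodB G x) : Good x := by
  simp only [goodB, Bool.or_eq_true, decide_eq_true_eq, List.any_eq_true, Bool.and_eq_true] at h
  obtain rfl | ⟨g, hg, h1, h2⟩ := h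
  · exact good_zero
  · exact (hG g hg).of_associated (associated_of_dvd_dvd (dvd_of_dvdB h1) (dvd_of_dvdB h2))

/-- Test whether, after division by `z`, one of the coordinates becomes good. -/
def redB (G : List Ord) (z x y : Ord) : Bool :=
  dvdB z x && dvdB z y && (goodB G (quo z x) || goodB G (quo z y))

lemma red_of_redB {G : List Ord} (hG : ∀ g ∈ G, Good g) {z x y : Ord} (h : redB G z x y) :
    Red ![x, y] := by
  simp only [redB, Bool.and_eq_true, Bool.or_eq_true] at h
  obtain ⟨⟨hx, hy⟩, h⟩ := h
  have : ![x, y] = z • ![quo z x, quo z y] := by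
    ext1 i; fin_cases i
    · exact eq_mul_quo hx
    · exact eq_mul_quo hy
  rw [this]
  apply Red.smul
  obtain h | h := h
  · exact (good_of_goodB hG h).red_left _
  · exact good_of_goodB hG h _

/-- A basis `m`, `r + n l`, `p + j s + q l`, `u + w s + v l + k s l` of the ideal generated by `y`,
together with representatives of all residue classes modulo `y`; those in the second list are
equipped with a common factor and the choice whether to apply `swap`. -/
structure Cover where
  y : Ord
  m : ℕ
  n : ℕ
  j : ℕ
  k : ℕ
  r : ℤ
  p : ℤ
  q : ℤ
  u : ℤ
  v : ℤ
  w : ℤ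
  reps : List Ord
  extraReps : List (Ord × Ord × Bool)

/-- Test whether the ideal generated by `C.y` contains the given basis, the elements of `C.reps` are
good, those of `C.extraReps` are reduced after multiplication by `swap` or removal of a common
factor, and both lists together exhaust the residue classes modulo `C.y`. -/
def coverB (G : List Ord) (C : Cover) : Bool :=
  (C.reps.all fun g ↦ goodB G g) &&
  (C.extraReps.all fun g ↦ if g.2.2 then
      redB G g.2.1 ((swap *ᵥ ![g.1, C.y]) 0) ((swap *ᵥ ![g.1, C.y]) 1)
    else redB G g.2.1 g.1 C.y) &&
  (decide (0 < C.m) && decide (0 < C.n) && decide (0 < C.j) && decide (0 < C.k) &&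
    dvdB C.y ⟨C.m, 0, 0, 0⟩ && dvdB C.y ⟨C.r, 0, C.n, 0⟩ &&
    dvdB C.y ⟨C.p, C.j, C.q, 0⟩ && dvdB C.y ⟨C.u, C.w, C.v, C.k⟩) &&
  (List.range C.m).all fun a ↦ (List.range C.j).all fun b ↦
    (List.range C.n).all fun c ↦ (List.range C.k).all fun d ↦
      (C.reps ++ C.extraReps.map Prod.fst).any fun h ↦ dvdB C.y (⟨a, b, c, d⟩ - h)

lemma exists_nat_lt_eq_add_mul (x : ℤ) {m : ℕ} (hm : 0 < m) :
    ∃ i < m, ∃ k : ℤ, x = i + m * k := by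
  obtain ⟨i, hi⟩ := Int.eq_ofNat_of_zero_le (Int.emod_nonneg x (Int.natCast_pos.2 hm).ne')
  have := Int.emod_lt_of_pos x (Int.natCast_pos.2 hm)
  exact ⟨i, by omega, x / m, by rw [← hi, Int.emod_add_mul_ediv]⟩

lemma exists_sub_dvd {A : List Ord} {y : Ord} {m n j k : ℕ} {r p q u v w : ℤ}
    (hm : 0 < m) (hn : 0 < n) (hj : 0 < j) (hk : 0 < k)
    (h1 : y ∣ ⟨m, 0, 0, 0⟩) (h2 : y ∣ ⟨r, 0, n, 0⟩) (h3 : y ∣ ⟨p, j, q, 0⟩) (h4 : y ∣ ⟨u, w, v, k⟩)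
    (hA : ∀ a < m, ∀ b < j, ∀ c < n, ∀ d < k, ∃ h ∈ A, y ∣ ⟨a, b, c, d⟩ - h) (x : Ord) :
    ∃ h ∈ A, y ∣ x - h := by
  obtain ⟨d, hd, d', hd'⟩ := exists_nat_lt_eq_add_mul x.d hk
  obtain ⟨b, hb, b', hb'⟩ := exists_nat_lt_eq_add_mul (x.b - d' * w) hj
  obtain ⟨c, hc, c', hc'⟩ := exists_nat_lt_eq_add_mul (x.c - d' * v - b' * q) hn
  obtain ⟨a, ha, a', ha'⟩ := exists_nat_lt_eq_add_mul (x.a - d' * u - b' * p - c' * r) hm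
  obtain ⟨h, hh, hdvd⟩ := hA a ha b hb c hc d hd
  refine ⟨h, hh, ?_⟩
  have := dvd_add (dvd_add (h1.mul_left (a' : Ord)) (h2.mul_left (c' : Ord)))
    (dvd_add (h3.mul_left (b' : Ord)) (h4.mul_left (d' : Ord)))
  convert dvd_add this hdvd using 1
  ext <;> simp <;> linarith

lemma good_of_coverB {G : List Ord} (hG : ∀ g ∈ G, Good g) {C : Cover} (h : coverB G C) :
    Good C.y := by
  simp only [coverB, Bool.and_eq_true, List.all_eq_true, decide_eq_true_eq, List.any_eq_true,
    List.mem_range] at h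
  obtain ⟨⟨⟨hL, hM⟩, ⟨⟨⟨⟨⟨⟨hm, hn⟩, hj⟩, hk⟩, h1⟩, h2⟩, h3⟩, h4⟩, hA⟩ := h
  intro x
  obtain ⟨g, hg, hd⟩ := exists_sub_dvd hm hn hj hk (dvd_of_dvdB h1) (dvd_of_dvdB h2)
    (dvd_of_dvdB h3) (dvd_of_dvdB h4) (fun a ha b hb c hc d hd ↦
      (hA a ha b hb c hc d hd).imp fun _ h ↦ ⟨h.1, dvd_of_dvdB h.2⟩) x
  refine .of_sub_dvd ?_ hd
  rw [List.mem_append, List.mem_map] at hg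
  obtain hg | ⟨m, hm, rfl⟩ := hg
  · exact (good_of_goodB hG (hL g hg)).red_left C.y
  · have := hM m hm
    split_ifs at this
    · apply Red.of_swap
      convert red_of_redB hG this using 1
      ext1 i; fin_cases i <;> rfl
    · exact red_of_redB hG this

/-- Run `coverB` along a list of candidates, each one relying on the previous ones. -/
def coversB : List Ord → List Cover → Bool
  | _, [] => true
  | G, c :: cs => coverB G c && coversB (c.y :: G) cs

lemma good_of_coversB {C : List Cover} {G : List Ord}
    (hG : ∀ g ∈ G, Good g) (h : coversB G C) : ∀ c ∈ C, Good c.y := by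
  induction C generalizing G with
  | nil => simp
  | cons c C ih =>
    rw [coversB, Bool.and_eq_true] at h
    have hc := good_of_coverB hG h.1
    have := ih (G := c.y :: G) (by simpa using ⟨hc, hG⟩) h.2
    exact fun d hd ↦ (List.mem_cons.1 hd).elim (fun e ↦ e ▸ hc) (this d)

/-- A list of covers, each one relying on the previous ones. -/
def covers : List Cover := [
  ⟨⟨0, 0, -1, 1⟩, 2, 2, 1, 1, 0, 1, 0, 0, -1, 0,
    [⟨0, 0, 0, 0⟩, ⟨-1, 0, 0, 0⟩, ⟨0, 0, -1, 0⟩],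
    [⟨⟨-1, 0, 1, 0⟩, ⟨0, 0, -1, 1⟩, true⟩]⟩,
  ⟨⟨-2, -1, -1, 0⟩, 6, 1, 1, 1, -1, 3, 0, -3, 0, 0,
    [⟨0, 0, 0, 0⟩, ⟨-1, 0, 0, 0⟩, ⟨1, 0, 0, 0⟩, ⟨0, 0, -1, 1⟩, ⟨0, 0, 1, -1⟩],
    [⟨⟨0, 0, 0, -1⟩, ⟨1, 0, 0, 0⟩, true⟩]⟩,
  ⟨⟨2, 1, -1, 0⟩, 6, 1, 1, 1, 1, 3, 0, 3, 0, 0,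
    [⟨0, 0, 0, 0⟩, ⟨-1, 0, 0, 0⟩, ⟨1, 0, 0, 0⟩, ⟨0, 0, -1, 1⟩, ⟨0, 0, 1, -1⟩],
    [⟨⟨0, 1, 0, 0⟩, ⟨-1, 0, -1, 0⟩, true⟩]⟩,
  ⟨⟨-1, 0, -1, 1⟩, 3, 3, 1, 1, 0, 1, 1, -1, -1, 0,
    [⟨0, 0, 0, 0⟩, ⟨-1, 0, 0, 0⟩, ⟨1, 0, 0, 0⟩, ⟨1, 0, -1, 0⟩, ⟨0, 0, -1, 0⟩, ⟨0, 0, 1, 0⟩,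
     ⟨-1, 0, 1, 0⟩, ⟨-1, 0, -1, 0⟩, ⟨1, 0, 1, 0⟩],
    []⟩,
  ⟨⟨0, 0, 0, 1⟩, 3, 3, 1, 1, 0, 0, 0, 0, 0, 0,
    [⟨0, 0, 0, 0⟩, ⟨-1, 0, 0, 0⟩, ⟨1, 0, 0, 0⟩, ⟨0, 0, 1, 0⟩, ⟨0, 0, -1, 0⟩, ⟨-1, 0, 1, 0⟩,
     ⟨-1, 0, -1, 0⟩, ⟨1, 0, 1, 0⟩, ⟨1, 0, -1, 0⟩],
    []⟩,
  ⟨⟨1, 1, -1, 0⟩, 3, 3, 1, 1, 0, 1, -1, 1, -1, 0,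
    [⟨0, 0, 0, 0⟩, ⟨-1, 0, 0, 0⟩, ⟨1, 0, 0, 0⟩, ⟨-1, 0, -1, 0⟩, ⟨0, 0, -1, 0⟩, ⟨0, 0, 1, 0⟩,
     ⟨1, 0, 1, 0⟩, ⟨0, -1, 0, 0⟩, ⟨0, 1, 0, 0⟩],
    []⟩,
  ⟨⟨-2, -1, 0, 1⟩, 22, 1, 1, 1, -5, 5, 0, 3, 0, 0,
    [⟨0, 0, 0, 0⟩, ⟨-1, 0, 0, 0⟩, ⟨1, 0, 0, 0⟩, ⟨0, 0, -2, 1⟩, ⟨0, 0, -1, 0⟩, ⟨0, 0, -1, 1⟩,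
     ⟨0, 0, 1, -1⟩, ⟨0, 0, 1, 0⟩, ⟨0, 0, 2, -1⟩, ⟨-1, 0, -1, 0⟩, ⟨-1, 0, 1, -1⟩, ⟨-1, 0, 1, 0⟩,
     ⟨-1, 0, 2, -1⟩, ⟨1, 0, -2, 1⟩, ⟨1, 0, -1, 0⟩, ⟨1, 0, -1, 1⟩, ⟨1, 0, 1, 0⟩, ⟨0, 0, -1, -1⟩,
     ⟨0, 0, 1, 1⟩, ⟨0, 0, 0, 1⟩, ⟨0, 0, 0, -1⟩],
    [⟨⟨1, -2, 0, 0⟩, ⟨0, -1, -1, 0⟩, true⟩]⟩,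
  ⟨⟨1, 0, 0, 1⟩, 22, 1, 1, 1, 9, -5, 0, 1, 0, 0,
    [⟨0, 0, 0, 0⟩, ⟨-1, 0, 0, 0⟩, ⟨1, 0, 0, 0⟩, ⟨0, -1, 0, 0⟩, ⟨0, 0, -1, 0⟩, ⟨0, 0, -1, 1⟩,
     ⟨0, 0, 1, -1⟩, ⟨0, 0, 1, 0⟩, ⟨0, 1, 0, 0⟩, ⟨-1, -1, 0, 0⟩, ⟨-1, 0, -1, 1⟩, ⟨-1, 0, 1, 0⟩,
     ⟨-1, 1, 0, 0⟩, ⟨1, -1, 0, 0⟩, ⟨1, 0, -1, 0⟩, ⟨1, 0, 1, -1⟩, ⟨1, 1, 0, 0⟩, ⟨2, 1, 1, 0⟩,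
     ⟨-2, -1, -1, 0⟩, ⟨-1, -1, -1, 0⟩, ⟨1, 1, 1, 0⟩],
    [⟨⟨-2, 0, 1, 0⟩, ⟨1, 0, 0, 0⟩, true⟩]⟩,
  ⟨⟨2, 1, 0, 1⟩, 22, 1, 1, 1, 5, 5, 0, -3, 0, 0,
    [⟨0, 0, 0, 0⟩, ⟨-1, 0, 0, 0⟩, ⟨1, 0, 0, 0⟩, ⟨0, 0, -2, 1⟩, ⟨0, 0, -1, 0⟩, ⟨0, 0, -1, 1⟩,
     ⟨0, 0, 1, -1⟩, ⟨0, 0, 1, 0⟩, ⟨0, 0, 2, -1⟩, ⟨0, 1, 1, 0⟩, ⟨-1, 0, -1, 0⟩, ⟨-1, 0, -1, 1⟩,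
     ⟨-1, 0, 1, 0⟩, ⟨1, 0, -1, 0⟩, ⟨1, 0, 1, -1⟩, ⟨1, 0, 1, 0⟩, ⟨0, -1, -1, 0⟩, ⟨0, 0, 1, 1⟩,
     ⟨0, 0, -1, -1⟩, ⟨0, 0, 0, -1⟩, ⟨0, 0, 0, 1⟩],
    [⟨⟨-1, 1, 1, 0⟩, ⟨0, -1, 1, 0⟩, true⟩]⟩,
  ⟨⟨1, 0, 0, -1⟩, 22, 1, 1, 1, -9, -5, 0, -1, 0, 0,
    [⟨0, 0, 0, 0⟩, ⟨-1, 0, 0, 0⟩, ⟨1, 0, 0, 0⟩, ⟨0, 1, 0, 0⟩, ⟨0, 0, -1, 0⟩, ⟨0, 0, -1, 1⟩,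
     ⟨0, 0, 1, -1⟩, ⟨0, 0, 1, 0⟩, ⟨0, -1, 0, 0⟩, ⟨-1, 1, 0, 0⟩, ⟨-1, 0, -1, 0⟩, ⟨-1, 0, 1, -1⟩,
     ⟨-1, -1, 0, 0⟩, ⟨1, 1, 0, 0⟩, ⟨1, 0, -1, 1⟩, ⟨1, 0, 1, 0⟩, ⟨1, -1, 0, 0⟩, ⟨-1, 0, 0, -1⟩,
     ⟨1, 0, 0, 1⟩, ⟨-1, -1, 1, 0⟩, ⟨1, 1, -1, 0⟩],
    [⟨⟨1, 2, 0, 0⟩, ⟨0, -1, -2, 1⟩, true⟩]⟩,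
  ⟨⟨1, 1, 1, 1⟩, 6, 2, 2, 1, 2, 0, 0, 1, 1, 1,
    [⟨0, 0, 0, 0⟩, ⟨-1, 0, 0, 0⟩, ⟨1, 0, 0, 0⟩, ⟨0, 0, -2, 1⟩, ⟨0, 0, -1, 0⟩, ⟨0, 0, -1, 1⟩,
     ⟨0, 0, 1, -1⟩, ⟨0, 0, 1, 0⟩, ⟨0, 0, 2, -1⟩, ⟨0, -1, -1, 0⟩, ⟨-1, 0, -1, 0⟩, ⟨0, -1, 0, 0⟩,
     ⟨-1, 0, 1, -1⟩, ⟨-1, 0, 1, 0⟩, ⟨-1, 0, 2, -1⟩, ⟨1, 0, -1, 0⟩, ⟨1, 0, -1, 1⟩, ⟨0, -1, 1, 0⟩,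
     ⟨0, 0, 0, -1⟩, ⟨-1, 1, 2, -1⟩],
    [⟨⟨-2, 0, 0, 0⟩, ⟨0, 0, -1, 1⟩, false⟩, ⟨⟨2, 0, 0, 0⟩, ⟨0, 0, -1, 1⟩, false⟩,
     ⟨⟨-2, 0, 1, -1⟩, ⟨0, 0, -1, 1⟩, false⟩, ⟨⟨-1, 0, 2, 0⟩, ⟨1, 0, 0, 0⟩, true⟩]⟩,
  ⟨⟨1, 1, -1, -1⟩, 6, 2, 2, 1, -2, 0, 0, -1, 1, -1,
    [⟨0, 0, 0, 0⟩, ⟨-1, 0, 0, 0⟩, ⟨1, 0, 0, 0⟩, ⟨0, 0, -2, 1⟩, ⟨0, 0, -1, 0⟩, ⟨0, 0, -1, 1⟩,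
     ⟨0, 0, 1, -1⟩, ⟨0, 0, 1, 0⟩, ⟨0, 0, 2, -1⟩, ⟨-1, 0, -2, 1⟩, ⟨-1, 0, -1, 0⟩, ⟨-1, 0, -1, 1⟩,
     ⟨0, -1, 0, 0⟩, ⟨-1, 0, 1, 0⟩, ⟨0, -1, 1, 0⟩, ⟨0, -1, -1, 0⟩, ⟨1, 0, 1, -1⟩, ⟨1, 0, 1, 0⟩,
     ⟨-1, -1, -1, 1⟩, ⟨1, -1, 1, -1⟩, ⟨-1, 1, -2, 1⟩, ⟨0, 0, 0, -1⟩],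
    [⟨⟨-2, 0, -1, 1⟩, ⟨0, 0, -1, 1⟩, false⟩, ⟨⟨1, 0, 2, 0⟩, ⟨-1, 0, -2, 1⟩, true⟩]⟩,
  ⟨⟨1, 1, 0, 1⟩, 5, 5, 1, 1, 0, -2, -2, -2, 2, 0,
    [⟨0, 0, 0, 0⟩, ⟨-1, 0, 0, 0⟩, ⟨1, 0, 0, 0⟩, ⟨0, 1, -1, 0⟩, ⟨0, 0, -1, 0⟩, ⟨0, 1, 0, 0⟩,
     ⟨0, -1, 0, 0⟩, ⟨0, 0, 1, 0⟩, ⟨0, -1, 1, 0⟩, ⟨1, 0, 1, 0⟩, ⟨-1, 0, -1, 0⟩, ⟨-1, 1, 0, 0⟩,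
     ⟨0, 0, 0, 1⟩, ⟨-1, 0, 1, 0⟩, ⟨0, 0, 1, 1⟩, ⟨0, 0, -1, -1⟩, ⟨1, 0, -1, 0⟩, ⟨0, 0, 0, -1⟩,
     ⟨1, -1, 0, 0⟩, ⟨-2, 1, 0, 0⟩, ⟨-1, 0, 0, 1⟩, ⟨1, 0, 0, -1⟩, ⟨2, -1, 0, 0⟩],
    [⟨⟨-1, 1, 0, 1⟩, ⟨1, 0, 0, 0⟩, true⟩, ⟨⟨-1, -1, 2, 0⟩, ⟨1, 0, 0, 0⟩, true⟩]⟩,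
  ⟨⟨-1, -1, 0, 1⟩, 5, 5, 1, 1, 0, -2, 2, 2, 2, 0,
    [⟨0, 0, 0, 0⟩, ⟨-1, 0, 0, 0⟩, ⟨1, 0, 0, 0⟩, ⟨0, -1, -1, 0⟩, ⟨0, 0, -1, 0⟩, ⟨0, -1, 0, 0⟩,
     ⟨0, 1, 0, 0⟩, ⟨0, 0, 1, 0⟩, ⟨0, 1, 1, 0⟩, ⟨0, 0, -1, -1⟩, ⟨-1, 0, -1, 0⟩, ⟨0, 0, 0, -1⟩,
     ⟨-1, 1, 0, 0⟩, ⟨-1, 0, 1, 0⟩, ⟨1, 0, -1, 0⟩, ⟨1, -1, 0, 0⟩, ⟨0, 0, 0, 1⟩, ⟨1, 0, 1, 0⟩,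
     ⟨0, 0, 1, 1⟩, ⟨-1, 0, 0, -1⟩, ⟨-2, 1, 0, 0⟩, ⟨1, 0, 0, 1⟩, ⟨2, -1, 0, 0⟩],
    [⟨⟨-2, 0, 0, 0⟩, ⟨1, 0, 0, 0⟩, true⟩, ⟨⟨-3, 0, 0, 0⟩, ⟨1, 0, 0, 0⟩, true⟩]⟩]

set_option maxRecDepth 100000 in
lemma coversB_covers : coversB [1] covers := by decide +kernel

/-- Numerators of the translates used in the Euclidean algorithm. -/
def shift : Fin 10 → Ord := ![⟨0, 0, 0, 0⟩, ⟨1, 0, 0, 0⟩, ⟨0, 0, 1, -1⟩, ⟨1, 0, 1, -1⟩,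
  ⟨0, 0, 1, 0⟩,
  ⟨2, 1, 1, 0⟩, ⟨2, 1, 0, -1⟩, ⟨0, 0, 0, -1⟩, ⟨-1, -1, 0, -1⟩, ⟨-1, -1, 1, 0⟩]

lemma shift_injective : Function.Injective shift := by decide +kernel

lemma good_of_mem_covers {g : Ord} (hg : g ∈ 1 :: covers.map Cover.y) : Good g := by
  obtain rfl | hg := List.mem_cons.1 hg
  · exact good_one
  · obtain ⟨c, hc, rfl⟩ := List.mem_map.1 hg
    exact good_of_coversB (fun g hg ↦ List.mem_singleton.1 hg ▸ good_one) coversB_covers c hc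

lemma goodB_shift_sub : ∀ i j : Fin 10,
    goodB (1 :: covers.map Cover.y) (shift i - shift j) := by
  decide +kernel

lemma good_shift_sub (i j : Fin 10) : Good (shift i - shift j) :=
  good_of_goodB (fun _ ↦ good_of_mem_covers) (goodB_shift_sub i j)

section form

open MeasureTheory
open scoped Pointwise

/-- The real quadratic form underlying `Quartic.P`. -/
def form (v : Fin 4 → ℝ) : ℝ :=
  v 0 ^ 2 + 3 * v 1 ^ 2 + 2 * v 2 ^ 2 + 6 * v 2 * v 3 + 6 * v 3 ^ 2

/-- A linear map pulling the Euclidean norm back to `form`. -/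
noncomputable def formMap : (Fin 4 → ℝ) →ₗ[ℝ] (Fin 4 → ℝ) :=
  Matrix.toLin' !![1, 0, 0, 0; 0, √3, 0, 0; 0, 0, √2, √2 * (3 / 2); 0, 0, 0, √3 / √2]

lemma det_formMap : LinearMap.det formMap = 3 := by
  have : √3 * (√2 * (√3 / √2)) = 3 := by
    rw [mul_div_cancel₀ _ (by positivity), Real.mul_self_sqrt (by norm_num)]
  rw [formMap, LinearMap.det_toLin', det_of_isUpperTriangular, Fin.prod_univ_four]
  · simpa [mul_assoc] using this
  · intro i j h
    fin_cases i <;> fin_cases j <;> simp_all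

lemma sum_formMap_sq (v : Fin 4 → ℝ) : ∑ i, formMap v i ^ 2 = form v := by
  have h2 : √2 ^ 2 = 2 := Real.sq_sqrt (by norm_num)
  have h3 : √3 ^ 2 = 3 := Real.sq_sqrt (by norm_num)
  have h4 : (√3 / √2) ^ 2 = 3 / 2 := by rw [div_pow, h2, h3]
  simp only [formMap, form, Fin.sum_univ_four, toLin'_apply, mulVec, dotProduct, of_apply, cons_val]
  linear_combination v 1 ^ 2 * h3 + v 3 ^ 2 * h4 + (v 2 + 3 / 2 * v 3) ^ 2 * h2

/-- The open ball of radius `1 / 2` for `form`. -/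
def formBall : Set (Fin 4 → ℝ) := formMap ⁻¹' (WithLp.toLp 2 ⁻¹' Metric.ball 0 (1 / 2))

lemma mem_formBall {v : Fin 4 → ℝ} : v ∈ formBall ↔ form v < 1 / 4 := by
  rw [formBall, Set.mem_preimage, Set.mem_preimage, Metric.mem_ball, dist_zero_right,
    ← sq_lt_sq₀ (norm_nonneg _) (by norm_num), EuclideanSpace.norm_sq_eq]
  simp only [Real.norm_eq_abs, sq_abs, sum_formMap_sq]
  norm_num

lemma measurableSet_formBall : MeasurableSet formBall :=
  (LinearMap.continuous_of_finiteDimensional formMap).measurable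
    ((PiLp.volume_preserving_toLp (Fin 4)).measurable measurableSet_ball)

lemma volume_formBall : volume formBall = ENNReal.ofReal (Real.pi ^ 2 / 96) := by
  rw [formBall, Measure.addHaar_preimage_linearMap _ (by rw [det_formMap]; norm_num),
    (PiLp.volume_preserving_toLp (Fin 4)).measure_preimage measurableSet_ball.nullMeasurableSet,
    EuclideanSpace.volume_ball, det_formMap, ← ENNReal.ofReal_pow (by norm_num),
    ← ENNReal.ofReal_mul (by positivity), ← ENNReal.ofReal_mul (by positivity)]
  congr 1
  have hG : Real.Gamma ((4 : ℕ) / 2 + 1) = 2 := by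
    rw [show ((4 : ℕ) / 2 + 1 : ℝ) = (2 : ℕ) + 1 by norm_num, Real.Gamma_nat_eq_factorial]
    norm_num
  have hp : √Real.pi ^ 4 = Real.pi ^ 2 := by
    rw [show 4 = 2 * 2 from rfl, pow_mul, Real.sq_sqrt Real.pi_nonneg]
  rw [Fintype.card_fin, hG, hp]
  norm_num
  ring

lemma form_nonneg (v : Fin 4 → ℝ) : 0 ≤ form v := by
  rw [← sum_formMap_sq]; positivity

lemma form_sub_lt {v w : Fin 4 → ℝ} (hv : v ∈ formBall) (hw : w ∈ formBall) :
    form (v - w) < 1 := by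
  rw [mem_formBall] at hv hw
  have := form_nonneg (v + w)
  simp only [form, Pi.sub_apply, Pi.add_apply] at *
  linarith

lemma eq_zero_of_form_lt {z : Fin 4 → ℤ} (h : form (fun k ↦ z k) < 1) : z = 0 := by
  have h' : z 0 ^ 2 + 3 * z 1 ^ 2 + 2 * z 2 ^ 2 + 6 * z 2 * z 3 + 6 * z 3 ^ 2 < 1 := by
    rw [form] at h
    exact_mod_cast h
  have hsq : 2 * (z 0 ^ 2 + 3 * z 1 ^ 2) + (2 * z 2 + 3 * z 3) ^ 2 + 3 * z 3 ^ 2 < 2 := by linarith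
  have h3 : z 3 = 0 := by
    by_contra hne
    have := sq_pos_of_ne_zero hne
    nlinarith [sq_nonneg (z 0), sq_nonneg (z 1), sq_nonneg (2 * z 2 + 3 * z 3)]
  rw [h3] at h'
  have key (k : Fin 4) (hk : z k ^ 2 < 1) : z k = 0 := by
    simpa using Int.abs_lt_one_iff.1 ((sq_lt_one_iff_abs_lt_one _).1 hk)
  ext k
  fin_cases k
  · exact key 0 (by nlinarith [sq_nonneg (z 1), sq_nonneg (z 2)])
  · exact key 1 (by nlinarith [sq_nonneg (z 0), sq_nonneg (z 2)])
  · exact key 2 (by nlinarith [sq_nonneg (z 0), sq_nonneg (z 1)])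
  · exact h3

/-- Among ten points, two are at `form`-distance less than `1` modulo `ℤ⁴`. -/
lemma exists_form_sub_lt (t : Fin 10 → Fin 4 → ℝ) :
    ∃ i j, i ≠ j ∧ ∃ x : Fin 4 → ℤ, form (fun k ↦ t i k - t j k - x k) < 1 := by
  by_contra! H
  have hdis : Pairwise (Function.onFun Disjoint fun i ↦ (t i +ᵥ formBall)) := by
    intro i j hij
    rw [Function.onFun, Set.disjoint_left]
    rintro _ ⟨v, hv, rfl⟩ ⟨w, hw, h⟩
    refine (H i j hij 0).not_gt ?_
    refine lt_of_eq_of_lt (congrArg form ?_) (form_sub_lt hw hv)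
    ext k
    have := congrFun h k
    simp at this ⊢
    linarith
  have hmeas : ∀ i, MeasurableSet (t i +ᵥ formBall) := fun i ↦
    measurableSet_formBall.const_vadd (t i)
  have hvol : volume (ZSpan.fundamentalDomain (Pi.basisFun ℝ (Fin 4))) <
      volume (⋃ i, (t i +ᵥ formBall)) := by
    rw [measure_iUnion hdis hmeas, tsum_fintype, ZSpan.fundamentalDomain_pi_basisFun]
    simp only [measure_vadd, volume_formBall, Real.volume_pi_Ico]
    have h3 := Real.pi_gt_d2
    rw [Finset.sum_const, Finset.card_univ, Fintype.card_fin, nsmul_eq_mul]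
    simp only [sub_zero, ENNReal.ofReal_one, Finset.prod_const_one]
    rw [← ENNReal.ofReal_one, ← ENNReal.ofReal_natCast, ← ENNReal.ofReal_mul (by norm_num),
      ENNReal.ofReal_lt_ofReal_iff (by positivity)]
    push_cast
    nlinarith
  have : Countable (Submodule.span ℤ (Set.range (Pi.basisFun ℝ (Fin 4)))).toAddSubgroup :=
    inferInstanceAs (Countable (Submodule.span ℤ (Set.range (Pi.basisFun ℝ (Fin 4)))))
  obtain ⟨x, y, hxy, h⟩ := exists_pair_mem_lattice_not_disjoint_vadd
    (ZSpan.isAddFundamentalDomain' (Pi.basisFun ℝ (Fin 4)) volume)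
    (MeasurableSet.iUnion hmeas).nullMeasurableSet hvol
  rw [Set.not_disjoint_iff] at h
  obtain ⟨_, ⟨v', hv', rfl⟩, ⟨w', hw', h⟩⟩ := h
  obtain ⟨i, v, hv, rfl⟩ := Set.mem_iUnion.1 hv'
  obtain ⟨j, w, hw, rfl⟩ := Set.mem_iUnion.1 hw'
  have hcoe : ∀ z ∈ Submodule.span ℤ (Set.range (Pi.basisFun ℝ (Fin 4))), ∀ k, ∃ n : ℤ, z k = n :=
    fun z hz k ↦ by
      simpa [eq_comm] using ((Pi.basisFun ℝ (Fin 4)).mem_span_iff_repr_mem ℤ z).1 hz k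
  choose z hz using hcoe (y.1 - x.1) (sub_mem y.2 x.2)
  have hlt : form (fun k ↦ t i k - t j k - z k) < 1 := by
    refine lt_of_eq_of_lt (congrArg form ?_) (form_sub_lt hw hv)
    ext k
    have h1 : y.1 k + (t j k + w k) = x.1 k + (t i k + v k) := congrFun h k
    have h2 := hz k
    rw [Pi.sub_apply] at h2 ⊢
    linarith
  obtain rfl | hij := eq_or_ne i j
  · refine hxy (Subtype.ext (sub_eq_zero.1 ?_)).symm
    have hz0 := eq_zero_of_form_lt (z := z) (by simpa [form] using hlt)
    ext k
    rw [hz, hz0]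
    simp
  · exact (H i j hij z).not_gt hlt

end form

lemma P_nonneg (x : Ord) : 0 ≤ x.P := by
  have h : 2 * x.P = 2 * x.a ^ 2 + 6 * x.b ^ 2 + (2 * x.c + 3 * x.d) ^ 2 + 3 * x.d ^ 2 := by
    rw [P]; ring
  have : 0 ≤ 2 * x.P := h ▸ by positivity
  linarith

lemma exists_good_norm_lt (p : Ord) {q : Ord} (hq : q ≠ 0) :
    ∃ x y : Ord, y ≠ 0 ∧ Good y ∧ N (x * q - y * p) < N q := by
  have hn := N_pos hq
  have hn' : ((N q : ℤ) : ℝ) ≠ 0 := by exact_mod_cast hn.ne'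
  let f (i : Fin 10) : Ord := shift i * (p * cof q)
  obtain ⟨i, j, hij, z, hz⟩ := exists_form_sub_lt fun i k ↦
    (![(f i).a, (f i).b, (f i).c, (f i).d] k : ℝ) / ((N q : ℤ) : ℝ)
  set x : Ord := ⟨z 0, z 1, z 2, z 3⟩ with hx
  set y := shift i - shift j with hy
  refine ⟨x, y, sub_ne_zero.2 fun h ↦ hij (shift_injective h), good_shift_sub i j, ?_⟩
  set u : Ord := f i - f j - N q • x with hu
  have hP : u.P < N q ^ 2 := by
    have : (u.P : ℝ) < (N q : ℤ) ^ 2 := by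
      calc (u.P : ℝ) = (N q : ℤ) ^ 2 * _ := ?_
        _ < (N q : ℤ) ^ 2 * 1 := mul_lt_mul_of_pos_left hz (by positivity)
        _ = (N q : ℤ) ^ 2 := mul_one _
      simp [form, P, hu, hx]
      field_simp
    exact_mod_cast this
  have hu' : u = -(cof q * (x * q - y * p)) := by
    have h1 : N q • x = q * cof q * x := by
      rw [mul_cof]; ext <;> simp
    rw [hu, hy, h1]; ring
  have hN : N u = N (cof q) * N (x * q - y * p) := by
    rw [hu', ← neg_one_mul, map_mul, map_mul, show N (-1 : Ord) = 1 by decide, one_mul]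
  have hlt : N u < N q ^ 4 := by
    have := N_le u
    have := P_nonneg u
    nlinarith
  have hc := N_cof q
  have hc' : N (cof q) = N q ^ 3 := by
    apply mul_left_cancel₀ hn.ne'
    rw [hc]; ring
  rw [hN, hc', pow_succ _ 3] at hlt
  exact lt_of_mul_lt_mul_left hlt (by positivity)

/-- Reduction modulo the prime above `2`. -/
def parity : Ord →+* ZMod 2 where
  toFun x := x.a + x.b + x.c + x.d
  map_one' := by simp
  map_mul' x y := by
    simp only [mul_a, mul_b, mul_c, mul_d]
    push_cast
    generalize (x.a : ZMod 2) = a, (x.b : ZMod 2) = b, (x.c : ZMod 2) = c, (x.d : ZMod 2) = d,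
      (y.a : ZMod 2) = a', (y.b : ZMod 2) = b', (y.c : ZMod 2) = c', (y.d : ZMod 2) = d'
    decide +revert
  map_zero' := by simp
  map_add' x y := by simp; ring

lemma even_N {x : Ord} : Even (N x) ↔ parity x = 0 := by
  rw [← ZMod.intCast_eq_zero_iff_even]
  simp only [N_def, P, Q, parity, RingHom.coe_mk, MonoidHom.coe_mk, OneHom.coe_mk]
  push_cast
  generalize (x.a : ZMod 2) = a, (x.b : ZMod 2) = b, (x.c : ZMod 2) = c, (x.d : ZMod 2) = d
  decide +revert

lemma two_le_N {x : Ord} (hx : x ≠ 0) (h : parity x = 0) : 2 ≤ N x := by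
  have := N_pos hx
  obtain ⟨k, hk⟩ := even_N.2 h
  omega

lemma N_ne_two (x : Ord) : N x ≠ 2 := by
  intro h
  have h3 := congrArg (Int.cast (R := ZMod 3)) h
  rw [N_def] at h3
  push_cast at h3
  generalize (x.P : ZMod 3) = a, (x.Q : ZMod 3) = b at h3
  revert a b
  decide

lemma β_dvd {z : Ord} (h1 : (z.a : ZMod 2) = z.b) (h2 : (z.c : ZMod 2) = z.d) : β ∣ z := by
  rw [ZMod.intCast_eq_intCast_iff_dvd_sub] at h1 h2
  obtain ⟨m, hm⟩ := h1
  obtain ⟨n, hn⟩ := h2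
  push_cast at hm hn
  refine ⟨⟨z.b + m, -m, z.d + n, -n⟩, ?_⟩
  ext <;> simp [β] <;> linarith

lemma β_dvd_mul {x y : Ord} (hx : parity x = 0) (hy : parity y = 0) : β ∣ x * y := by
  simp only [parity, RingHom.coe_mk, MonoidHom.coe_mk, OneHom.coe_mk] at hx hy
  apply β_dvd <;>
  · simp only [mul_a, mul_b, mul_c, mul_d]
    push_cast
    generalize (x.a : ZMod 2) = a, (x.b : ZMod 2) = b, (x.c : ZMod 2) = c, (x.d : ZMod 2) = d,
      (y.a : ZMod 2) = a', (y.b : ZMod 2) = b', (y.c : ZMod 2) = c', (y.d : ZMod 2) = d' at *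
    decide +revert

lemma N_β : N β = 4 := by decide

lemma parity_swap (i j : Fin 2) : parity (swap i j) = 0 := by
  decide +revert

lemma parity_mulVec {v : Fin 2 → Ord} (M : Matrix (Fin 2) (Fin 2) Ord)
    (h : ∀ i, parity (v i) = 0) (i : Fin 2) : parity ((M *ᵥ v) i) = 0 := by
  simp [mulVec, dotProduct, h]

lemma parity_swap_mulVec (v : Fin 2 → Ord) (i : Fin 2) : parity ((swap *ᵥ v) i) = 0 := by
  simp [mulVec, dotProduct, parity_swap]

lemma exists_swap_mulVec_eq {v : Fin 2 → Ord} (h : ∀ i, parity (v i) = 0) :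
    ∃ v', swap *ᵥ v = β • v' := by
  have (i : Fin 2) : β ∣ (swap *ᵥ v) i := by
    rw [mulVec, dotProduct]
    exact Finset.dvd_sum fun j _ ↦ β_dvd_mul (parity_swap i j) (h j)
  choose v' hv' using this
  exact ⟨v', funext hv'⟩

/-- The determinant of two column vectors. -/
def cross (w v : Fin 2 → Ord) : Ord := w 0 * v 1 - w 1 * v 0

lemma cross_mulVec (M : Matrix (Fin 2) (Fin 2) Ord) (w v : Fin 2 → Ord) :
    cross (M *ᵥ w) (M *ᵥ v) = M.det * cross w v := by
  simp only [cross, mulVec, dotProduct, Fin.sum_univ_two, det_fin_two]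
  ring

lemma cross_SL_mulVec (M : Matrix.SpecialLinearGroup (Fin 2) Ord) (w v : Fin 2 → Ord) :
    cross (M.1 *ᵥ w) (M.1 *ᵥ v) = cross w v := by
  rw [cross_mulVec, M.2, one_mul]

lemma N_cross_eq {w : Fin 2 → Ord} (v : Fin 2 → Ord) (h : w 1 = 0) :
    N (cross w v) = N (w 0) * N (v 1) := by
  rw [cross, h, zero_mul, sub_zero, map_mul]

lemma mulVec_apply_zero_ne {M : Matrix (Fin 2) (Fin 2) Ord} (hM : M.det ≠ 0) {w : Fin 2 → Ord}
    (hw : w 1 ≠ 0) (h : (M *ᵥ w) 1 = 0) : (M *ᵥ w) 0 ≠ 0 := by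
  intro h0
  have := eq_zero_of_mulVec_eq_zero hM (v := w) (by ext1 i; fin_cases i; exacts [h0, h])
  exact hw (congrFun this 1)

lemma red_of_norm_le (n : ℕ) : ∀ v : Fin 2 → Ord,
    (N (v 1) ≤ n → Red v) ∧ ((∀ i, parity (v i) = 0) → N (v 1) ≤ 2 * n → Red v) := by
  have base {v : Fin 2 → Ord} (h : v 1 = 0) : Red v := .inl ⟨1, one_mem _, by simpa using h⟩
  induction n with
  | zero =>
    refine fun v ↦ ⟨fun h ↦ ?_, fun _ h ↦ ?_⟩ <;>
      exact base (N_eq_zero.1 (le_antisymm (by simpa using h) (N_nonneg _)))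
  | succ n ih =>
    intro v
    by_cases hv : v 1 = 0
    · exact ⟨fun _ ↦ base hv, fun _ _ ↦ base hv⟩
    obtain ⟨x, y, hy, hg, hlt⟩ := exists_good_norm_lt (v 0) hv
    replace hlt : N (cross ![x, y] v) < N (v 1) := hlt
    have hr := hg x
    set w := ![x, y]
    have hw : w 1 ≠ 0 := hy
    obtain ⟨e, he, h⟩ | ⟨e, he, h⟩ := hr
    · have hd := N_pos (mulVec_apply_zero_ne (by rw [e.2]; exact one_ne_zero) hw h)
      have hc := N_cross_eq (e.1 *ᵥ v) h
      rw [cross_SL_mulVec] at hc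
      have h0 := N_nonneg ((e.1 *ᵥ v) 1)
      refine ⟨fun hn ↦ .of_mulVec he ((ih _).1 ?_),
        fun hp hn ↦ .of_mulVec he ((ih _).2 (parity_mulVec _ hp) ?_)⟩
      · push_cast at hn; nlinarith
      · have hev : Even (N (cross w v)) := even_N.2 (by simp [cross, hp])
        obtain ⟨k, hk⟩ := hev
        push_cast at hn
        have : N (cross w v) ≤ 2 * n := by omega
        nlinarith
    · rw [mulVec_mulVec] at h
      have hdet : (e.1 * swap).det = β := by rw [det_mul, e.2, one_mul, det_swap]
      have hd := mulVec_apply_zero_ne (by rw [hdet]; exact β_ne_zero) hw h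
      rw [← mulVec_mulVec] at h hd
      have hd2 := two_le_N hd (parity_mulVec _ (parity_swap_mulVec w) 0)
      have key (v' : Fin 2 → Ord) := N_cross_eq (e.1 *ᵥ v') h
      simp only [cross_SL_mulVec] at key
      refine ⟨fun hn ↦ .of_swap (.of_mulVec he
        ((ih _).2 (parity_mulVec _ (parity_swap_mulVec v)) ?_)), fun hp hn ↦ ?_⟩
      · have hc := key (swap *ᵥ v)
        rw [cross_mulVec, map_mul, det_swap, N_β] at hc
        have h0 := N_nonneg ((e.1 *ᵥ swap *ᵥ v) 1)
        push_cast at hn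
        nlinarith
      · obtain ⟨v', hv'⟩ := exists_swap_mulVec_eq hp
        have hc := key v'
        have hcr : cross (swap *ᵥ w) v' = cross w v := by
          apply mul_left_cancel₀ β_ne_zero
          have h1 : β * cross (swap *ᵥ w) v' = cross (swap *ᵥ w) (β • v') := by
            simp only [cross, Pi.smul_apply, smul_eq_mul]; ring
          rw [h1, ← hv', cross_mulVec, det_swap]
        rw [hcr] at hc
        have hev : Even (N (cross w v)) := even_N.2 (by simp [cross, hp])
        obtain ⟨k, hk⟩ := hev
        have h0 := N_nonneg ((e.1 *ᵥ v') 1)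
        push_cast at hn
        refine .of_swap ?_
        rw [hv']
        refine .smul _ (.of_mulVec he ((ih _).1 ?_))
        have : N (cross w v) ≤ 2 * n := by omega
        nlinarith

lemma red (v : Fin 2 → Ord) : Red v :=
  (red_of_norm_le (N (v 1)).toNat v).1 (Int.self_le_toNat _)

theorem elementary_eq_top : elementary Ord = ⊤ := by
  rw [eq_top_iff]
  rintro M -
  obtain ⟨e, he, h⟩ | ⟨e, he, h⟩ := red fun i ↦ M.1 i 0
  · refine ((elementary Ord).mul_mem_cancel_left he).1 (mem_elementary_of_isUnit ?_)
    have h10 : (e * M).1 1 0 = 0 := by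
      rw [Matrix.SpecialLinearGroup.coe_mul]; exact h
    have := (e * M).2
    rw [det_fin_two, h10, mul_zero, sub_zero] at this
    exact .of_mul_eq_one _ this
  · exfalso
    set w : Fin 2 → Ord := fun i ↦ M.1 i 1
    have hc := N_cross_eq (e.1 *ᵥ swap *ᵥ w) h
    have hM : cross (fun i ↦ M.1 i 0) w = 1 := by
      have := M.2
      rw [det_fin_two] at this
      simp only [cross, w]
      linear_combination this
    rw [cross_SL_mulVec, cross_mulVec, hM, mul_one, det_swap, N_β] at hc
    have hne (x : Ord) (hx : N x ≠ 0) (hp : parity x = 0) : 3 ≤ N x := by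
      have := two_le_N (fun h0 ↦ hx (N_eq_zero.2 h0)) hp
      have := N_ne_two x
      omega
    have h1 := hne _ (fun h0 ↦ by rw [h0, zero_mul] at hc; omega)
      (parity_mulVec e.1 (parity_swap_mulVec fun i ↦ M.1 i 0) 0)
    have h2 := hne _ (fun h0 ↦ by rw [h0, mul_zero] at hc; omega)
      (parity_mulVec e.1 (parity_swap_mulVec w) 1)
    nlinarith

/-- The homomorphisms from the order onto `𝔽₃`, determined by the image `e` of `l`. -/
def residue (e : ZMod 3) (he : e ^ 2 = 1) : Ord →+* ZMod 3 where
  toFun x := x.a + e * x.c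
  map_one' := by simp
  map_mul' x y := by
    simp only [mul_a, mul_c]
    push_cast
    have h3 : (3 : ZMod 3) = 0 := rfl
    linear_combination (x.b * y.b - x.c * y.c - x.c * y.d - x.d * y.c - 2 * x.d * y.d +
      e * (x.b * y.d + x.d * y.b)) * h3 - x.c * y.c * he
  map_zero' := by simp
  map_add' x y := by simp; ring

/-- The `ε`-component of the reduction of the order to the dual numbers `𝔽₂[ε]`, for which `parity`
is the constant component. -/
def infinitesimal : Ord →+ ZMod 2 where
  toFun x := x.c + x.d
  map_zero' := by simp
  map_add' x y := by simp; ring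

lemma infinitesimal_mul (x y : Ord) :
    infinitesimal (x * y) = parity x * infinitesimal y + infinitesimal x * parity y := by
  simp only [infinitesimal, parity, RingHom.coe_mk, MonoidHom.coe_mk, OneHom.coe_mk,
    AddMonoidHom.coe_mk, ZeroHom.coe_mk, mul_c, mul_d]
  push_cast
  generalize (x.a : ZMod 2) = a, (x.b : ZMod 2) = b, (x.c : ZMod 2) = c, (x.d : ZMod 2) = d,
    (y.a : ZMod 2) = a', (y.b : ZMod 2) = b', (y.c : ZMod 2) = c', (y.d : ZMod 2) = d'
  decide +revert

/-- The abelianization map of `SL₂(𝔽₃)`. -/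
def ab₃ : Matrix.SpecialLinearGroup (Fin 2) (ZMod 3) →* Multiplicative (ZMod 3) where
  toFun M := .ofAdd ((1 - M 1 0 ^ 2) * M 0 1 * M 1 1 + M 1 0 * (M 0 0 + M 1 1))
  map_one' := by simp
  map_mul' M M' := by
    have h := M.2
    have h' := M'.2
    rw [det_fin_two] at h h'
    rw [← ofAdd_add]
    congr 1
    simp only [Matrix.SpecialLinearGroup.coe_mul, mul_apply, Fin.sum_univ_two]
    generalize M.1 0 0 = a, M.1 0 1 = b, M.1 1 0 = c, M.1 1 1 = d, M'.1 0 0 = a', M'.1 0 1 = b',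
      M'.1 1 0 = c', M'.1 1 1 = d' at *
    clear M M'
    revert a b c d h a' b' c' d' h'
    decide +kernel

/-- The abelianization map of `SL₂(𝔽₂)`. -/
def ab₂ : Matrix.SpecialLinearGroup (Fin 2) (ZMod 2) →* Multiplicative (ZMod 2) where
  toFun M := .ofAdd (M 1 0 * M 1 1 + M 0 1 * M 1 0 + M 0 0 * M 0 1)
  map_one' := by simp
  map_mul' M M' := by
    have h := M.2
    have h' := M'.2
    rw [det_fin_two] at h h'
    rw [← ofAdd_add]
    congr 1
    simp only [Matrix.SpecialLinearGroup.coe_mul, mul_apply, Fin.sum_univ_two]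
    generalize M.1 0 0 = a, M.1 0 1 = b, M.1 1 0 = c, M.1 1 1 = d, M'.1 0 0 = a', M'.1 0 1 = b',
      M'.1 1 0 = c', M'.1 1 1 = d' at *
    clear M M'
    revert a b c d h a' b' c' d' h'
    decide +kernel

lemma abε_mul_left : ∀ a b c d : ZMod 2, a * d - b * c = 1 →
    ∀ a' b' c' d' : ZMod 2, a' * d' - b' * c' = 1 →
    ∀ α β γ δ : ZMod 2, a * δ + α * d - (b * γ + β * c) = 0 →
    (c * a' + d * c') * (γ * b' + δ * d') + (γ * a' + δ * c') * (c * b' + d * d') +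
      (α * b' + β * d') * (c * a' + d * c') + (α * a' + β * c') * (c * b' + d * d') +
      (a * a' + b * c') * (α * b' + β * d') + (α * a' + β * c') * (a * b' + b * d') =
    c * δ + γ * d + β * c + α * d + a * β + α * b := by
  decide +kernel

lemma abε_mul_right : ∀ a b c d : ZMod 2, a * d - b * c = 1 →
    ∀ a' b' c' d' : ZMod 2, a' * d' - b' * c' = 1 →
    ∀ α β γ δ : ZMod 2, a' * δ + α * d' - (b' * γ + β * c') = 0 →
    (c * a' + d * c') * (c * β + d * δ) + (c * α + d * γ) * (c * b' + d * d') +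
      (a * β + b * δ) * (c * a' + d * c') + (a * α + b * γ) * (c * b' + d * d') +
      (a * a' + b * c') * (a * β + b * δ) + (a * α + b * γ) * (a * b' + b * d') =
    c' * δ + γ * d' + β * c' + α * d' + a' * β + α * b' := by
  decide +kernel

/-- The `ε`-component of the abelianization map of `SL₂(𝔽₂[ε])`, pulled back to the order. -/
def abε : Matrix.SpecialLinearGroup (Fin 2) Ord →* Multiplicative (ZMod 2) where
  toFun M := .ofAdd (parity (M 1 0) * infinitesimal (M 1 1) + infinitesimal (M 1 0) * parity (M 1 1)
    + infinitesimal (M 0 1) * parity (M 1 0) + infinitesimal (M 0 0) * parity (M 1 1)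
    + parity (M 0 0) * infinitesimal (M 0 1) + infinitesimal (M 0 0) * parity (M 0 1))
  map_one' := by simp [infinitesimal]
  map_mul' M M' := by
    have h := M.2
    have h' := M'.2
    rw [det_fin_two] at h h'
    have hpar := congrArg parity h
    have hpar' := congrArg parity h'
    have hinf := congrArg infinitesimal h
    have hinf' := congrArg infinitesimal h'
    rw [show infinitesimal 1 = 0 from rfl] at hinf hinf'
    simp only [map_sub, map_mul, map_one, infinitesimal_mul] at hpar hpar' hinf hinf'
    rw [← ofAdd_add]
    congr 1
    simp only [Matrix.SpecialLinearGroup.coe_mul, mul_apply, Fin.sum_univ_two, map_add, map_mul,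
      infinitesimal_mul]
    clear h h'
    generalize parity (M.1 0 0) = a, parity (M.1 0 1) = b, parity (M.1 1 0) = c,
      parity (M.1 1 1) = d, parity (M'.1 0 0) = a', parity (M'.1 0 1) = b',
      parity (M'.1 1 0) = c', parity (M'.1 1 1) = d', infinitesimal (M.1 0 0) = α,
      infinitesimal (M.1 0 1) = β, infinitesimal (M.1 1 0) = γ, infinitesimal (M.1 1 1) = δ,
      infinitesimal (M'.1 0 0) = α', infinitesimal (M'.1 0 1) = β',
      infinitesimal (M'.1 1 0) = γ', infinitesimal (M'.1 1 1) = δ' at *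
    linear_combination abε_mul_left a b c d hpar a' b' c' d' hpar' α β γ δ hinf +
      abε_mul_right a b c d hpar a' b' c' d' hpar' α' β' γ' δ' hinf'

/-- The image of the upper unitriangular group in the abelianization. -/
def upperAb (R : Type*) [CommRing R] : R →+ SL2ab R where
  toFun t := .ofMul (Abelianization.of (upper t))
  map_zero' := by rw [upper_zero, map_one, ofMul_one]
  map_add' x y := by rw [upper_add, map_mul, ofMul_mul]

lemma upperAb_surjective {R : Type*} [CommRing R] (h : elementary R = ⊤) :
    Function.Surjective (upperAb R) := by
  intro z
  obtain ⟨M, hM⟩ := QuotientGroup.mk_surjective z.toMul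
  suffices ∀ M ∈ elementary R, ∃ t, upperAb R t = .ofMul (Abelianization.of M) by
    obtain ⟨t, ht⟩ := this M (h ▸ Subgroup.mem_top M)
    exact ⟨t, ht.trans (congrArg Additive.ofMul hM)⟩
  intro M hM
  induction hM using Subgroup.closure_induction with
  | mem M hM =>
    obtain ⟨t, rfl⟩ | ⟨t, rfl⟩ := hM
    · exact ⟨t, rfl⟩
    · refine ⟨-t, congrArg Additive.ofMul ?_⟩
      rw [lower_eq, map_mul, map_mul, map_inv, mul_inv_cancel_comm]
  | one => exact ⟨0, map_zero _⟩
  | mul x y _ _ hx hy =>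
    obtain ⟨t, ht⟩ := hx
    obtain ⟨u, hu⟩ := hy
    exact ⟨t + u, by rw [map_add, ht, hu, map_mul, ofMul_mul]⟩
  | inv x _ hx =>
    obtain ⟨t, ht⟩ := hx
    exact ⟨-t, by rw [map_neg, ht, map_inv, ofMul_inv]⟩

lemma upperAb_sq_mul {R : Type*} [CommRing R] {u v : R} (h : u * v = 1) (t : R) :
    upperAb R (u ^ 2 * t) = upperAb R t := by
  have : upper (u ^ 2 * t) = diag h * upper t * (diag h)⁻¹ := by
    rw [eq_mul_inv_iff_mul_eq]
    apply Subtype.ext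
    simp only [Matrix.SpecialLinearGroup.coe_mul, coe_upper, coe_diag, mul_fin_two]
    ext i j
    fin_cases i <;> fin_cases j <;> simp
    linear_combination (u * t) * h
  refine congrArg Additive.ofMul ?_
  rw [this, map_mul, map_mul, map_inv, mul_inv_cancel_comm]

lemma upperAb_eq_zero {t : Ord} (h : (⟨3, 1, 0, 0⟩ : Ord) ∣ t) : upperAb Ord t = 0 := by
  obtain ⟨w, rfl⟩ := h
  have h1 := upperAb_sq_mul (u := (⟨0, 0, 1, 0⟩ : Ord)) (v := ⟨0, 0, -2, 1⟩) (by decide) w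
  rw [show (⟨0, 0, 1, 0⟩ : Ord) ^ 2 = 1 - ⟨3, 1, 0, 0⟩ by decide, sub_mul, one_mul, map_sub,
    sub_eq_self] at h1
  exact h1

/-- The map detecting the abelianization of `SL₂` of the order. -/
def abMap : SL2ab Ord →+ (ZMod 2 × ZMod 3) × (ZMod 2 × ZMod 3) :=
  let lift {k : ℕ} (f : Matrix.SpecialLinearGroup (Fin 2) Ord →* Multiplicative (ZMod k)) :
    SL2ab Ord →+ ZMod k := MonoidHom.toAdditiveLeft (Abelianization.lift f)
  ((lift (ab₂.comp (Matrix.SpecialLinearGroup.map parity))).prod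
    (lift (ab₃.comp (Matrix.SpecialLinearGroup.map (residue 1 rfl))))).prod
  ((lift abε).prod (lift (ab₃.comp (Matrix.SpecialLinearGroup.map (residue (-1) rfl)))))

lemma abMap_upperAb (t : Ord) : abMap (upperAb Ord t) =
    ((parity t, residue 1 rfl t), (infinitesimal t, residue (-1) rfl t)) := by
  have h2 : ab₂ (Matrix.SpecialLinearGroup.map parity (upper t)) = .ofAdd (parity t) := by
    simp [ab₂]
  have h3 (e : ZMod 3) (he : e ^ 2 = 1) :
      ab₃ (Matrix.SpecialLinearGroup.map (residue e he) (upper t)) = .ofAdd (residue e he t) := by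
    simp [ab₃]
  have hε : abε (upper t) = .ofAdd (infinitesimal t) := by
    simp [abε, infinitesimal]
  exact Prod.ext (Prod.ext h2 (h3 1 rfl)) (Prod.ext hε (h3 (-1) rfl))

lemma abMap_surjective : Function.Surjective abMap := by
  rintro ⟨⟨p, u⟩, q, v⟩
  refine ⟨upperAb Ord ⟨(-(u + v)).val, p.val - q.val - (-(u + v)).val, (v - u).val,
    q.val - (v - u).val⟩, ?_⟩
  rw [abMap_upperAb]
  revert p u q v
  decide +kernel

lemma abMap_injective : Function.Injective abMap := by
  rw [injective_iff_map_eq_zero]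
  intro z hz
  obtain ⟨t, rfl⟩ := upperAb_surjective elementary_eq_top z
  apply upperAb_eq_zero
  simp only [abMap_upperAb, Prod.mk_eq_zero, parity, infinitesimal, residue, RingHom.coe_mk,
    MonoidHom.coe_mk, OneHom.coe_mk, AddMonoidHom.coe_mk, ZeroHom.coe_mk] at hz
  obtain ⟨⟨h1, h2⟩, h3, h4⟩ := hz
  have e1 := (ZMod.intCast_zmod_eq_zero_iff_dvd (t.a + t.b + t.c + t.d) 2).1
    (by push_cast; exact h1)
  have e2 := (ZMod.intCast_zmod_eq_zero_iff_dvd (t.a + t.c) 3).1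
    (by push_cast; linear_combination h2)
  have e3 := (ZMod.intCast_zmod_eq_zero_iff_dvd (t.c + t.d) 2).1 (by push_cast; exact h3)
  have e4 := (ZMod.intCast_zmod_eq_zero_iff_dvd (t.a - t.c) 3).1
    (by push_cast; linear_combination h4)
  push_cast at e1 e2 e3 e4
  refine ⟨⟨(t.a - t.b) / 2, (3 * t.b - t.a) / 6, (t.c - t.d) / 2, (3 * t.d - t.c) / 6⟩, ?_⟩
  ext <;> simp <;> omega

/-- The abelianization of `SL₂` of the order. -/
noncomputable def abEquiv : SL2ab Ord ≃+ ZMod 6 × ZMod 6 :=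
  (AddEquiv.ofBijective abMap ⟨abMap_injective, abMap_surjective⟩).trans <|
    have e : ZMod 6 ≃+ ZMod 2 × ZMod 3 :=
      (ZMod.chineseRemainder (m := 2) (n := 3) (by norm_num)).toAddEquiv
    e.symm.prodCongr e.symm

/-- Isomorphic rings have isomorphic abelianizations of `SL₂`. -/
def sl2abCongr {R S : Type*} [CommRing R] [CommRing S] (e : R ≃+* S) : SL2ab R ≃+ SL2ab S :=
  MulEquiv.toAdditive <| MulEquiv.abelianizationCongr <|
    MonoidHom.toMulEquiv (Matrix.SpecialLinearGroup.map e) (Matrix.SpecialLinearGroup.map e.symm)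
      (by ext; simp) (by ext; simp)

end QuarticOrder

/-- for the ring of integers of `K = ℚ(√−2, √3)`,
the abelianization of `SL₂` is `ℤ/6 ⊕ ℤ/6`. -/
theorem sl2_abelianization_Q_sqrt_neg_two_sqrt_three
    (K : Type*) [Field K] [NumberField K]
    (hdeg : Module.finrank ℚ K = 4)
    (a b : K) (ha : a ^ 2 = -2) (hb : b ^ 2 = 3) :
    Nonempty (SL2ab (𝓞 K) ≃+ (ZMod 6 × ZMod 6)) := by
  obtain ⟨e⟩ := QuarticOrder.nonempty_ringOfIntegers_equiv hdeg ha hb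
  exact ⟨(QuarticOrder.sl2abCongr e).trans QuarticOrder.abEquiv⟩
end
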